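/- N_R(M) = Σ_{i=0}^{d} dim_k Soc(H^i_m(M)) if and only if M is sequentially Cohen-Macaulay. -/

import Mathlib

open IsLocalRing

universe u

namespace Paper

variable (R : Type u) [CommRing R]

/-- `dim_{R/I} Soc_I(N)` where `Soc_I(N) = (0 :_N I)`. -/
noncomputable def socDim (I : Ideal R) (N : Type u) [AddCommGroup N] [Module R N] : ℕ :=
  Module.finrank (R ⧸ I) (Submodule.torsionBySet R N (I : Set R))

/-- Krull dimension of a module (`⊥` for the zero module). -/
noncomputable def mdim (M : Type u) [AddCommGroup M] [Module R M] : WithBot (WithTop ℕ) :=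
  ringKrullDim (R ⧸ Module.annihilator R M)

/-- The index of reducibility of an ideal `q` on `M`: `dim_k Soc (M/qM)`. -/
noncomputable def ir [IsLocalRing R] (M : Type u) [AddCommGroup M] [Module R M]
    (q : Ideal R) : ℕ :=
  socDim R (maximalIdeal R) (M ⧸ (q • ⊤ : Submodule R M))

/-- `dim_k Soc (H^i_m(M))`. -/
noncomputable def socH [IsLocalRing R] (M : Type u) [AddCommGroup M] [Module R M] (i : ℕ) : ℕ :=
  socDim R (maximalIdeal R) ((localCohomology (maximalIdeal R) i).obj (ModuleCat.of R M))

/-- A system of parameters of `M` (of length `d`): `d` elements of the maximal ideal such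
that the quotient has finite length. -/
def IsSOP [IsLocalRing R] (M : Type u) [AddCommGroup M] [Module R M] (d : ℕ)
    (x : Fin d → R) : Prop :=
  (∀ i, x i ∈ maximalIdeal R) ∧
    IsFiniteLength R (M ⧸ (Ideal.span (Set.range x) • ⊤ : Submodule R M))

/-- A parameter element: an element occurring in some system of parameters of `M`. -/
def IsParamElement [IsLocalRing R] (M : Type u) [AddCommGroup M] [Module R M] (d : ℕ)
    (a : R) : Prop :=
  ∃ x : Fin d → R, IsSOP R M d x ∧ ∃ i, x i = a

/-- The ideal `b(M) = ⋂ Ann (0 :_{M/(x_1,...,x_{i-1})M} x_i)`, the intersection running over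
all systems of parameters `x_1, ..., x_d` of `M`. -/
noncomputable def bIdeal [IsLocalRing R] (M : Type u) [AddCommGroup M] [Module R M]
    (d : ℕ) : Ideal R :=
  ⨅ (x : Fin d → R) (_ : IsSOP R M d x) (i : Fin d),
    Module.annihilator R
      (Submodule.torsionBy R (M ⧸ (Ideal.span (x '' {j | j < i}) • ⊤ : Submodule R M)) (x i))

/-- A C-system of parameters: `x_i ∈ b(M/(x_{i+1},...,x_d)M)^3` for all `i`. -/
def IsCSOP [IsLocalRing R] (M : Type u) [AddCommGroup M] [Module R M] (d : ℕ)
    (x : Fin d → R) : Prop :=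
  IsSOP R M d x ∧ ∀ i : Fin d,
    x i ∈ (bIdeal R (M ⧸ (Ideal.span (x '' {j | i < j}) • ⊤ : Submodule R M)) ((i : ℕ) + 1)) ^ 3

/-- The depth of `M`: the supremum of the lengths of `M`-regular sequences contained in the
maximal ideal. -/
noncomputable def depth [IsLocalRing R] (M : Type u) [AddCommGroup M] [Module R M] :
    WithTop ℕ :=
  sSup {n : WithTop ℕ | ∃ rs : List R, (rs.length : WithTop ℕ) = n ∧
    (∀ r ∈ rs, r ∈ maximalIdeal R) ∧ RingTheory.Sequence.IsRegular M rs}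

/-- `M` is a Cohen-Macaulay module: `depth M = dim M`. -/
def IsCM [IsLocalRing R] (M : Type u) [AddCommGroup M] [Module R M] : Prop :=
  (depth R M : WithBot (WithTop ℕ)) = mdim R M

/-- A Cohen-Macaulay local ring. -/
def IsCMLocalRing (S : Type u) [CommRing S] [IsLocalRing S] : Prop :=
  IsNoetherianRing S ∧ IsCM S S

/-- `R` is a homomorphic image of a Cohen-Macaulay (Noetherian) local ring. -/
def IsQuotientOfCMLocalRing : Prop :=
  ∃ (S : Type u) (_ : CommRing S) (_ : IsLocalRing S),
    IsCMLocalRing S ∧ ∃ f : S →+* R, Function.Surjective f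

/-- The largest submodule of (the submodule) `N` whose dimension is strictly smaller than
that of `N`. -/
noncomputable def uComp (M : Type u) [AddCommGroup M] [Module R M] (N : Submodule R M) :
    Submodule R M :=
  sSup {P : Submodule R M | P ≤ N ∧ mdim R P < mdim R N}

/-- The unmixed component `U_M(0)` of `M`: the largest submodule of dimension `< dim M`. -/
noncomputable def unmixedComp (M : Type u) [AddCommGroup M] [Module R M] : Submodule R M :=
  uComp R M ⊤

/-- The 0-th local cohomology `H^0_m(M)` realized as the submodule of elements annihilated by
some power of the maximal ideal. -/
def H0sub [IsLocalRing R] (M : Type u) [AddCommGroup M] [Module R M] : Submodule R M :=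
  ⨆ n : ℕ, Submodule.torsionBySet R M (((maximalIdeal R) ^ n : Ideal R) : Set R)

/-- The quotient `P/N` of two submodules of `M`. -/
abbrev subQuot (M : Type u) [AddCommGroup M] [Module R M] (P N : Submodule R M) :=
  P ⧸ (Submodule.comap P.subtype N)

/-- `D_0 ⊆ D_1 ⊆ ⋯ ⊆ D_t = M` is the dimension filtration of `M`:
`D_t = M`, each `D_{i-1}` is the largest submodule of `D_i` of strictly smaller dimension,
and `D_0 = H^0_m(M)`. -/
def IsDimFiltration [IsLocalRing R] (M : Type u) [AddCommGroup M] [Module R M]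
    (t : ℕ) (D : Fin (t + 1) → Submodule R M) : Prop :=
  D (Fin.last t) = ⊤ ∧ (∀ i : Fin t, D i.castSucc = uComp R M (D i.succ)) ∧
    D 0 = H0sub R M

/-- `M` is sequentially Cohen-Macaulay: all quotients `D_i/D_{i-1}` of the dimension
filtration are Cohen-Macaulay. -/
def IsSeqCM [IsLocalRing R] (M : Type u) [AddCommGroup M] [Module R M] : Prop :=
  ∃ (t : ℕ) (D : Fin (t + 1) → Submodule R M), IsDimFiltration R M t D ∧
    ∀ i : Fin t, IsCM R (subQuot R M (D i.succ) (D i.castSucc))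

/-- `M` (of dimension `d`) is generalized Cohen-Macaulay: `H^i_m(M)` has finite length
for all `i < d`. -/
def IsGenCM [IsLocalRing R] (M : Type u) [AddCommGroup M] [Module R M] (d : ℕ) : Prop :=
  ∀ i < d, IsFiniteLength R ((localCohomology (maximalIdeal R) i).obj (ModuleCat.of R M))

/-- `α_n(M)`: the minimum of the indices of reducibility of parameter ideals of `M`
contained in `m^n`. -/
noncomputable def alphaN [IsLocalRing R] (M : Type u) [AddCommGroup M] [Module R M]
    (d n : ℕ) : ℕ :=
  sInf {r : ℕ | ∃ x : Fin d → R, IsSOP R M d x ∧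
    Ideal.span (Set.range x) ≤ (maximalIdeal R) ^ n ∧ r = ir R M (Ideal.span (Set.range x))}

/-- The limit value `α(M) = lim_n α_n(M)` (the supremum of the non-decreasing sequence). -/
noncomputable def alphaLim [IsLocalRing R] (M : Type u) [AddCommGroup M] [Module R M]
    (d : ℕ) : ℕ :=
  ⨆ n : ℕ, alphaN R M d (n + 1)

/-- `M` is unmixed: `dim R/p = dim M` for all associated primes `p`. -/
def IsUnmixed (M : Type u) [AddCommGroup M] [Module R M] : Prop :=
  ∀ p ∈ associatedPrimes R M, ringKrullDim (R ⧸ p) = mdim R M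

/-- Serre's condition `(S_2)` for a module. -/
def IsS2 (L : Type u) [AddCommGroup L] [Module R L] : Prop :=
  ∀ p : PrimeSpectrum R, p ∈ Module.support R L →
    min 2 (mdim (Localization.AtPrime p.asIdeal) (LocalizedModule p.asIdeal.primeCompl L)) ≤
      (depth (Localization.AtPrime p.asIdeal) (LocalizedModule p.asIdeal.primeCompl L) :
        WithBot (WithTop ℕ))

/-- `ι : M →ₗ[R] S` exhibits `S` as an `S_2`-ification of `M`. -/
def IsS2ification [IsLocalRing R] (M S : Type u) [AddCommGroup M] [Module R M]
    [AddCommGroup S] [Module R S] (ι : M →ₗ[R] S) : Prop :=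
  Function.Injective ι ∧ Module.Finite R S ∧ IsS2 R S ∧
    ∀ (p : Ideal R) [p.IsPrime], p ≠ maximalIdeal R →
      IsS2 (Localization.AtPrime p) (LocalizedModule p.primeCompl M) →
      Function.Surjective (IsLocalizedModule.map p.primeCompl
        (LocalizedModule.mkLinearMap p.primeCompl M)
        (LocalizedModule.mkLinearMap p.primeCompl S) ι)

end Paper

open Paper IsLocalRing

section part1
open CategoryTheory Opposite Limits
namespace LC
variable {R : Type u} [CommRing R]

/-- The (old) `Ext` module used in the definition of local cohomology. -/
noncomputable abbrev OExt (X Y : ModuleCat.{u} R) (n : ℕ) : ModuleCat.{u} R :=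
  ((Ext R (ModuleCat.{u} R) n).obj (op X)).obj Y

/-- `e` is represented by the cocycle `f`. -/
def Rep {X Y : ModuleCat.{u} R} (P : ProjectiveResolution X) (n : ℕ) (f : P.complex.X n ⟶ Y)
    (e : OExt X Y n) : Prop :=
  ∃ z : ((P.complex.linearYonedaObj R Y).cycles n : ModuleCat.{u} R),
    ((P.complex.linearYonedaObj R Y).iCycles n).hom z = f ∧
    (P.isoExt (R := R) n Y).inv.hom (((P.complex.linearYonedaObj R Y).homologyπ n).hom z) = e

variable {X Y : ModuleCat.{u} R} (P : ProjectiveResolution X) (n : ℕ)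

lemma Rep.exists_of_cocycle (f : P.complex.X n ⟶ Y) (hf : P.complex.d (n+1) n ≫ f = 0) :
    ∃ e, Rep P n f e := by
  let K := P.complex.linearYonedaObj R Y
  have h := K.i_cyclesMk (i := n) f (n+1) (by simp) hf
  exact ⟨_, K.cyclesMk (i := n) f (n+1) (by simp) hf, h, rfl⟩

lemma Rep.cocycle {f : P.complex.X n ⟶ Y} {e} (h : Rep P n f e) :
    P.complex.d (n+1) n ≫ f = 0 := by
  obtain ⟨z, rfl, -⟩ := h
  have := (P.complex.linearYonedaObj R Y).iCycles_d n (n+1)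
  have := congrArg (fun g => g.hom z) this
  exact this

lemma Rep.exists_of_ext (e : OExt X Y n) : ∃ f, Rep P n f e := by
  let K := P.complex.linearYonedaObj R Y
  have : Function.Surjective (K.homologyπ n).hom :=
    (ModuleCat.epi_iff_surjective _).1 inferInstance
  obtain ⟨z, hz⟩ := this ((P.isoExt (R := R) n Y).hom.hom e)
  refine ⟨(K.iCycles n).hom z, z, rfl, ?_⟩
  change (P.isoExt (R := R) n Y).inv.hom ((K.homologyπ n).hom z) = e
  rw [hz]
  simp

lemma Rep.add {f g : P.complex.X n ⟶ Y} {e e'} (h : Rep P n f e) (h' : Rep P n g e') :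
    Rep P n (f + g) (e + e') := by
  obtain ⟨z, rfl, rfl⟩ := h
  obtain ⟨z', rfl, rfl⟩ := h'
  exact ⟨z + z', map_add _ _ _, by simp⟩

lemma Rep.smul (r : R) {f : P.complex.X n ⟶ Y} {e} (h : Rep P n f e) :
    Rep P n (r • f) (r • e) := by
  obtain ⟨z, rfl, rfl⟩ := h
  exact ⟨r • z, map_smul _ _ _, by simp⟩

lemma iCycles_inj (K : CochainComplex (ModuleCat.{u} R) ℕ) (n : ℕ) :
    Function.Injective (K.iCycles n).hom :=
  (ModuleCat.mono_iff_injective _).1 inferInstance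

lemma Rep.zero_iff {f : P.complex.X n ⟶ Y} {e} (h : Rep P n f e) (k : ℕ) (hk : k + 1 = n) :
    e = 0 ↔ ∃ g : P.complex.X k ⟶ Y, P.complex.d n k ≫ g = f := by
  obtain ⟨z, rfl, rfl⟩ := h
  let K := P.complex.linearYonedaObj R Y
  have hinj : Function.Injective (P.isoExt (R := R) n Y).inv.hom :=
    (ModuleCat.mono_iff_injective _).1 inferInstance
  rw [map_eq_zero_iff _ hinj]
  have hex : (ShortComplex.mk (K.toCycles k n) (K.homologyπ n) (by simp)).Exact := by
    apply ShortComplex.exact_of_g_is_cokernel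
    exact K.homologyIsCokernel k n (by simp [← hk])
  rw [ShortComplex.moduleCat_exact_iff] at hex
  constructor
  · intro hz
    obtain ⟨g, hg⟩ := hex z hz
    refine ⟨g, ?_⟩
    have := congrArg (fun φ => φ.hom g) (K.toCycles_i k n)
    simp only [ModuleCat.hom_comp, LinearMap.comp_apply] at this
    dsimp at hg
    rw [hg] at this
    exact this.symm
  · rintro ⟨g, hg⟩
    have : (K.toCycles k n).hom g = z := by
      apply iCycles_inj K n
      have := congrArg (fun φ => φ.hom g) (K.toCycles_i k n)
      exact this.trans hg
    rw [← this]
    have := congrArg (fun φ => φ.hom g) (K.toCycles_comp_homologyπ k n)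
    exact this

lemma Rep.zero_iff_zero {f : P.complex.X 0 ⟶ Y} {e} (h : Rep P 0 f e) :
    e = 0 ↔ f = 0 := by
  obtain ⟨z, rfl, rfl⟩ := h
  let K := P.complex.linearYonedaObj R Y
  have hinj : Function.Injective (P.isoExt (R := R) 0 Y).inv.hom :=
    (ModuleCat.mono_iff_injective _).1 inferInstance
  rw [map_eq_zero_iff _ hinj]
  have := CochainComplex.isIso_homologyπ₀ K
  have h2 : Function.Injective (K.homologyπ 0).hom :=
    (ModuleCat.mono_iff_injective _).1 inferInstance
  rw [map_eq_zero_iff _ h2]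
  exact (map_eq_zero_iff _ (iCycles_inj K 0)).symm

end LC
end part1

section part2
open CategoryTheory Opposite Limits
namespace LC
variable {R : Type u} [CommRing R]

lemma homologyUnop_nat {V : Type*} [Category V] [Abelian V] {ι : Type*} {c : ComplexShape ι}
    {K L : HomologicalComplex Vᵒᵖ c} (ψ : K ⟶ L) (i : ι) :
    (L.homologyUnop i).hom ≫ (HomologicalComplex.homologyMap ψ i).unop =
      HomologicalComplex.homologyMap ((HomologicalComplex.unopFunctor V c).map ψ.op) i ≫
        (K.homologyUnop i).hom := by
  have := HomologicalComplex.homologyOp_hom_naturality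
    ((HomologicalComplex.unopFunctor V c).map ψ.op) i
  have h2 := congrArg Quiver.Hom.unop this
  exact h2

lemma unop_conj {V : Type*} [Category V] {A B A' B' : Vᵒᵖ} (e : A ≅ B) (e' : A' ≅ B')
    (ψ : B ⟶ B') {H H' : V} (a : H ⟶ B'.unop) (a' : H' ⟶ B.unop) (m : H ⟶ H')
    (h : a ≫ ψ.unop = m ≫ a') :
    (a ≫ e'.hom.unop) ≫ (e.hom ≫ ψ ≫ e'.inv).unop = m ≫ (a' ≫ e.hom.unop) := by
  have : e'.hom.unop ≫ (e.hom ≫ ψ ≫ e'.inv).unop = ψ.unop ≫ e.hom.unop := by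
    rw [← unop_comp, ← unop_comp]; simp
  rw [Category.assoc, this, ← Category.assoc, h, Category.assoc]

variable {X Y : ModuleCat.{u} R} (P : ProjectiveResolution X) (n : ℕ)

/-- the map of complexes induced by `g` -/
noncomputable def yMap {Y' : ModuleCat.{u} R} (g : Y ⟶ Y') :
    P.complex.linearYonedaObj R Y ⟶ P.complex.linearYonedaObj R Y' :=
  (HomologicalComplex.unopFunctor _ _).map
    ((NatTrans.mapHomologicalComplex (NatTrans.rightOp ((linearYoneda R (ModuleCat.{u} R)).map g))
      (ComplexShape.down ℕ)).app P.complex).op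

lemma isoExt_inv_map {Y' : ModuleCat.{u} R} (g : Y ⟶ Y') :
    (P.isoExt (R := R) n Y).inv ≫ ((Ext R (ModuleCat.{u} R) n).obj (op X)).map g =
      HomologicalComplex.homologyMap (yMap P g) n ≫ (P.isoExt (R := R) n Y').inv := by
  have h1 : ((Ext R (ModuleCat.{u} R) n).obj (op X)).map g =
    ((NatTrans.leftDerived (NatTrans.rightOp
      ((linearYoneda R (ModuleCat.{u} R)).map g)) n).app X).unop := rfl
  rw [h1, ProjectiveResolution.leftDerived_app_eq _ P n]
  have h2 := homologyUnop_nat ((NatTrans.mapHomologicalComplex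
    (NatTrans.rightOp ((linearYoneda R (ModuleCat.{u} R)).map g))
      (ComplexShape.down ℕ)).app P.complex) n
  exact unop_conj _ _ _ _ _ _ h2

lemma Rep.map {Y' : ModuleCat.{u} R} (g : Y ⟶ Y') {f : P.complex.X n ⟶ Y} {e}
    (h : Rep P n f e) :
    Rep P n (f ≫ g) ((((Ext R (ModuleCat.{u} R) n).obj (op X)).map g).hom e) := by
  obtain ⟨z, rfl, rfl⟩ := h
  refine ⟨(HomologicalComplex.cyclesMap (yMap P g) n).hom z, ?_, ?_⟩
  · have := congrArg (fun φ => φ.hom z) (HomologicalComplex.cyclesMap_i (yMap P g) n)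
    exact this
  · have h1 := congrArg (fun φ => φ.hom z) (HomologicalComplex.homologyπ_naturality (yMap P g) n)
    have h2 := congrArg (fun φ => φ.hom (((P.complex.linearYonedaObj R Y).homologyπ n).hom z))
      (isoExt_inv_map P n g)
    refine Eq.trans ?_ h2.symm
    exact congrArg (fun t => (P.isoExt (R := R) n Y').inv.hom t) h1.symm

/-- the map of complexes induced by a map of resolutions -/
noncomputable def xMap {X' : ModuleCat.{u} R} {P' : ProjectiveResolution X'} {g : X' ⟶ X}
    (φ : ProjectiveResolution.Hom P' P g) :
    P.complex.linearYonedaObj R Y ⟶ P'.complex.linearYonedaObj R Y :=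
  (HomologicalComplex.unopFunctor _ _).map
    ((((linearYoneda R (ModuleCat.{u} R)).obj Y).rightOp.mapHomologicalComplex _).map φ.hom).op

lemma isoExt_inv_map' {X' : ModuleCat.{u} R} {P' : ProjectiveResolution X'} {g : X' ⟶ X}
    (φ : ProjectiveResolution.Hom P' P g) :
    (P.isoExt (R := R) n Y).inv ≫ ((Ext R (ModuleCat.{u} R) n).map g.op).app Y =
      HomologicalComplex.homologyMap (xMap (Y := Y) P φ) n ≫ (P'.isoExt (R := R) n Y).inv := by
  have h1 : ((Ext R (ModuleCat.{u} R) n).map g.op).app Y =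
    ((((linearYoneda R (ModuleCat.{u} R)).obj Y).rightOp.leftDerived n).map g).unop := rfl
  rw [h1, Functor.leftDerived_map_eq _ n g φ.hom (P := P') (Q := P) φ.hom_comp_π]
  have h2 := homologyUnop_nat
    ((((linearYoneda R (ModuleCat.{u} R)).obj Y).rightOp.mapHomologicalComplex _).map φ.hom) n
  exact unop_conj _ _ _ _ _ _ h2

lemma Rep.map' {X' : ModuleCat.{u} R} {P' : ProjectiveResolution X'} {g : X' ⟶ X}
    (φ : ProjectiveResolution.Hom P' P g) {f : P.complex.X n ⟶ Y} {e}
    (h : Rep P n f e) :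
    Rep P' n (φ.hom.f n ≫ f) ((((Ext R (ModuleCat.{u} R) n).map g.op).app Y).hom e) := by
  obtain ⟨z, rfl, rfl⟩ := h
  refine ⟨(HomologicalComplex.cyclesMap (xMap P φ) n).hom z, ?_, ?_⟩
  · have := congrArg (fun φ => φ.hom z) (HomologicalComplex.cyclesMap_i (xMap (Y := Y) P φ) n)
    exact this
  · have h1 := congrArg (fun φ => φ.hom z)
      (HomologicalComplex.homologyπ_naturality (xMap (Y := Y) P φ) n)
    have h2 := congrArg (fun φ => φ.hom (((P.complex.linearYonedaObj R Y).homologyπ n).hom z))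
      (isoExt_inv_map' (Y := Y) P n φ)
    refine Eq.trans ?_ h2.symm
    exact congrArg (fun t => (P'.isoExt (R := R) n Y).inv.hom t) h1.symm

end LC
end part2

section part3
open CategoryTheory Opposite Limits
namespace LC
variable {R : Type u} [CommRing R]
variable {X Y : ModuleCat.{u} R}

open CochainComplex HomComplex in
lemma extMk_zero_iff_zero (P : ProjectiveResolution X) (f : P.complex.X 0 ⟶ Y)
    (hf : P.complex.d 1 0 ≫ f = 0) :
    P.extMk f 1 rfl hf = 0 ↔ f = 0 := by
  refine ⟨fun h => ?_, fun h => by subst h; exact P.extMk_zero 1 rfl⟩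
  rw [← P.extEquivCohomologyClass.apply_eq_iff_eq,
    ProjectiveResolution.extEquivCohomologyClass_extMk,
    ProjectiveResolution.extEquivCohomologyClass_zero,
    CohomologyClass.mk_eq_zero_iff] at h
  rw [Cocycle.toSingleMk_mem_coboundaries_iff _ _ _ _ _ 1 (by simp)] at h
  obtain ⟨g, hg⟩ := h
  have h0 : g = 0 := (CochainComplex.isZero_of_isStrictlyLE P.cochainComplex 0 1).eq_of_src _ _
  rw [h0, comp_zero] at hg
  rw [← cancel_epi (P.cochainComplexXIso (-((0:ℕ):ℤ)) 0 rfl).hom, ← hg, comp_zero]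

/-- Comparison between the two `Ext`s. -/
def Cmp (n : ℕ) (a : Abelian.Ext.{u} X Y n) (e : OExt X Y n) : Prop :=
  ∃ (f : (projectiveResolution X).complex.X n ⟶ Y)
    (hf : (projectiveResolution X).complex.d (n+1) n ≫ f = 0),
    (projectiveResolution X).extMk f (n+1) rfl hf = a ∧ Rep (projectiveResolution X) n f e

variable {n : ℕ}

lemma Cmp.left (a : Abelian.Ext.{u} X Y n) : ∃ e, Cmp n a e := by
  obtain ⟨f, hf, h⟩ := (projectiveResolution X).extMk_surjective a (n+1) rfl
  obtain ⟨e, he⟩ := Rep.exists_of_cocycle _ n f hf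
  exact ⟨e, f, hf, h, he⟩

lemma Cmp.right (e : OExt X Y n) : ∃ a, Cmp n a e := by
  obtain ⟨f, hf⟩ := Rep.exists_of_ext (projectiveResolution X) n e
  exact ⟨_, f, hf.cocycle, rfl, hf⟩

lemma Cmp.add {a a' : Abelian.Ext.{u} X Y n} {e e'} (h : Cmp n a e) (h' : Cmp n a' e') :
    Cmp n (a + a') (e + e') := by
  obtain ⟨f, hf, rfl, hr⟩ := h
  obtain ⟨f', hf', rfl, hr'⟩ := h'
  exact ⟨f + f', by simp [hf, hf'], (ProjectiveResolution.add_extMk ..).symm, hr.add _ _ hr'⟩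

lemma Cmp.smul (r : R) {a : Abelian.Ext.{u} X Y n} {e} (h : Cmp n a e) :
    Cmp n (r • a) (r • e) := by
  obtain ⟨f, hf, rfl, hr⟩ := h
  refine ⟨r • f, by simp [hf], ?_, hr.smul _ _ r⟩
  rw [Abelian.Ext.smul_eq_comp_mk₀, ProjectiveResolution.extMk_comp_mk₀]
  congr 1

lemma Cmp.zero_iff {a : Abelian.Ext.{u} X Y n} {e} (h : Cmp n a e) : a = 0 ↔ e = 0 := by
  obtain ⟨f, hf, rfl, hr⟩ := h
  cases n with
  | zero => rw [extMk_zero_iff_zero, hr.zero_iff_zero]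
  | succ n => rw [ProjectiveResolution.extMk_eq_zero_iff _ _ _ _ _ n rfl, hr.zero_iff _ _ n rfl]

lemma Cmp.map {Y' : ModuleCat.{u} R} (g : Y ⟶ Y') {a : Abelian.Ext.{u} X Y n} {e}
    (h : Cmp n a e) :
    Cmp n (a.comp (Abelian.Ext.mk₀ g) (add_zero n))
      ((((Ext R (ModuleCat.{u} R) n).obj (op X)).map g).hom e) := by
  obtain ⟨f, hf, rfl, hr⟩ := h
  exact ⟨f ≫ g, by simp [reassoc_of% hf], (ProjectiveResolution.extMk_comp_mk₀ ..).symm,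
    hr.map _ _ g⟩

lemma Cmp.map' {X' : ModuleCat.{u} R} (g : X' ⟶ X) {a : Abelian.Ext.{u} X Y n} {e}
    (h : Cmp n a e) :
    Cmp n ((Abelian.Ext.mk₀ g).comp a (zero_add n))
      ((((Ext R (ModuleCat.{u} R) n).map g.op).app Y).hom e) := by
  obtain ⟨f, hf, rfl, hr⟩ := h
  let φ : ProjectiveResolution.Hom (projectiveResolution X') (projectiveResolution X) g :=
    { hom := ProjectiveResolution.lift g _ _
      hom_f_zero_comp_π_f_zero := by
        have := HomologicalComplex.congr_hom (ProjectiveResolution.lift_commutes g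
          (projectiveResolution X') (projectiveResolution X)) 0
        exact this }
  have h := ProjectiveResolution.mk₀_comp_extMk f (n+1) rfl hf φ
  exact ⟨φ.hom.f n ≫ f, by rw [← φ.hom.comm_assoc, hf, comp_zero], h.symm, hr.map' _ _ φ⟩

lemma Cmp.sub {a a' : Abelian.Ext.{u} X Y n} {e e'} (h : Cmp n a e) (h' : Cmp n a' e') :
    Cmp n (a - a') (e - e') := by
  have := h.add (h'.smul (-1))
  simpa [sub_eq_add_neg] using this

lemma Cmp.unique {a : Abelian.Ext.{u} X Y n} {e e'} (h : Cmp n a e) (h' : Cmp n a e') :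
    e = e' := by
  have := (h.sub h').zero_iff.1 (by simp)
  exact sub_eq_zero.1 this

variable (X Y n) in
/-- The linear equivalence between the two versions of `Ext`. -/
noncomputable def kap : Abelian.Ext.{u} X Y n →ₗ[R] OExt X Y n where
  toFun a := (Cmp.left a).choose
  map_add' a b := (Cmp.left _).choose_spec.unique
    ((Cmp.left a).choose_spec.add (Cmp.left b).choose_spec)
  map_smul' r a := (Cmp.left _).choose_spec.unique
    ((Cmp.left a).choose_spec.smul r)

lemma kap_spec (a : Abelian.Ext.{u} X Y n) : Cmp n a (kap X Y n a) := (Cmp.left a).choose_spec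

lemma kap_surj : Function.Surjective (kap X Y n) := fun e => by
  obtain ⟨a, h⟩ := Cmp.right e
  exact ⟨a, (kap_spec a).unique h⟩

lemma kap_eq_zero (a : Abelian.Ext.{u} X Y n) : kap X Y n a = 0 ↔ a = 0 :=
  (kap_spec a).zero_iff.symm

lemma kap_map {Y' : ModuleCat.{u} R} (g : Y ⟶ Y') (a : Abelian.Ext.{u} X Y n) :
    (((Ext R (ModuleCat.{u} R) n).obj (op X)).map g).hom (kap X Y n a) =
      kap X Y' n (a.comp (Abelian.Ext.mk₀ g) (add_zero n)) :=
  ((kap_spec a).map g).unique (kap_spec _)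

lemma kap_map' {X' : ModuleCat.{u} R} (g : X' ⟶ X) (a : Abelian.Ext.{u} X Y n) :
    (((Ext R (ModuleCat.{u} R) n).map g.op).app Y).hom (kap X Y n a) =
      kap X' Y n ((Abelian.Ext.mk₀ g).comp a (zero_add n)) :=
  ((kap_spec a).map' g).unique (kap_spec _)

end LC
end part3

section part4
open CategoryTheory Opposite Limits
namespace LC
variable {R : Type u} [CommRing R]

/-- `R / J^n` -/
noncomputable abbrev RJ (J : Ideal R) (n : ℕ) : ModuleCat.{u} R := ModuleCat.of R (R ⧸ J ^ n)

/-- the projection -/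
noncomputable def prj (J : Ideal R) {n k : ℕ} (h : n ≤ k) : RJ J k ⟶ RJ J n :=
  (localCohomology.ringModIdeals (localCohomology.idealPowersDiagram J)).map (homOfLE h).op

/-- local cohomology -/
noncomputable abbrev H (J : Ideal R) (i : ℕ) (M : ModuleCat.{u} R) : ModuleCat.{u} R :=
  (localCohomology J i).obj M

/-- functoriality of local cohomology -/
noncomputable abbrev Hm (J : Ideal R) (i : ℕ) {M N : ModuleCat.{u} R} (f : M ⟶ N) :
    H J i M →ₗ[R] H J i N :=
  ((localCohomology J i).map f).hom

/-- colimit cocone -/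
noncomputable def coc (J : Ideal R) (i : ℕ) :
    Cocone (localCohomology.diagram (localCohomology.idealPowersDiagram J) i) :=
  colimit.cocone (localCohomology.diagram (localCohomology.idealPowersDiagram J) i)

noncomputable def cocIs (J : Ideal R) (i : ℕ) : IsColimit (coc J i) :=
  colimit.isColimit _

noncomputable def cocEv (J : Ideal R) (i : ℕ) (M : ModuleCat.{u} R) :
    IsColimit (((evaluation _ _).obj M).mapCocone (coc J i)) :=
  isColimitOfPreserves _ (cocIs J i)

/-- The structure map. -/
noncomputable def cmap (J : Ideal R) (i n : ℕ) (M : ModuleCat.{u} R) :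
    Abelian.Ext.{u} (RJ J n) M i →ₗ[R] H J i M :=
  (((coc J i).ι.app (op (op n))).app M).hom ∘ₗ kap (RJ J n) M i

noncomputable instance forget_small :
    PreservesFilteredColimitsOfSize.{0, 0} (forget (ModuleCat.{u} R)) :=
  preservesSmallestFilteredColimits_of_preservesFilteredColimits _

variable (J : Ideal R) (i : ℕ) {M : ModuleCat.{u} R}

lemma cmap_surj (ξ : H J i M) : ∃ n e, cmap J i n M e = ξ := by
  obtain ⟨j, y, hy⟩ := Concrete.isColimit_exists_rep _ (cocEv J i M) ξ
  obtain ⟨e, rfl⟩ := kap_surj (X := RJ J j.unop.unop) y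
  exact ⟨j.unop.unop, e, hy⟩

lemma diag_map {n k : ℕ} (h : n ≤ k) (e : Abelian.Ext.{u} (RJ J n) M i) :
    (((localCohomology.diagram (localCohomology.idealPowersDiagram J) i).map
      (homOfLE h).op.op).app M).hom (kap (RJ J n) M i e) =
      kap (RJ J k) M i ((Abelian.Ext.mk₀ (prj J h)).comp e (zero_add i)) :=
  kap_map' (prj J h) e

lemma cmap_trans {n k : ℕ} (h : n ≤ k) (e : Abelian.Ext.{u} (RJ J n) M i) :
    cmap J i k M ((Abelian.Ext.mk₀ (prj J h)).comp e (zero_add i)) = cmap J i n M e := by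
  have := congrArg (fun t => (t.app M).hom (kap (RJ J n) M i e))
    ((coc J i).w (homOfLE h).op.op)
  refine Eq.trans ?_ this
  exact congrArg (((coc J i).ι.app (op (op k))).app M).hom (diag_map J i h e).symm

lemma cmap_eq_zero {n : ℕ} (e : Abelian.Ext.{u} (RJ J n) M i) (h0 : cmap J i n M e = 0) :
    ∃ k, ∃ h : n ≤ k, (Abelian.Ext.mk₀ (prj J h)).comp e (zero_add i) = 0 := by
  have h1 : ((((evaluation _ _).obj M).mapCocone (coc J i)).ι.app (op (op n))).hom
    (kap (RJ J n) M i e) = ((((evaluation _ _).obj M).mapCocone (coc J i)).ι.app (op (op n))).hom 0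
    := by rw [map_zero]; exact h0
  obtain ⟨k, f, g, hfg⟩ := Concrete.isColimit_exists_of_rep_eq _ (cocEv J i M) _ _ h1
  refine ⟨k.unop.unop, leOfHom f.unop.unop, ?_⟩
  rw [← kap_eq_zero, ← diag_map]
  refine Eq.trans hfg ?_
  exact map_zero _

lemma Hm_cmap {N : ModuleCat.{u} R} (f : M ⟶ N) {n : ℕ} (e : Abelian.Ext.{u} (RJ J n) M i) :
    Hm J i f (cmap J i n M e) = cmap J i n N (e.comp (Abelian.Ext.mk₀ f) (add_zero i)) := by
  have := congrArg (fun t => t.hom (kap (RJ J n) M i e)) (((coc J i).ι.app (op (op n))).naturality f)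
  refine Eq.trans this.symm ?_
  exact congrArg (((coc J i).ι.app (op (op n))).app N).hom (kap_map f e)

end LC
end part4

section part5
open CategoryTheory Opposite Limits
namespace LC
variable {R : Type u} [CommRing R] (J : Ideal R)

/-- local cohomology, unbundled -/
noncomputable abbrev HH (i : ℕ) (M : Type u) [AddCommGroup M] [Module R M] : ModuleCat.{u} R :=
  (localCohomology J i).obj (ModuleCat.of R M)

section
variable (i : ℕ) {M N L : Type u} [AddCommGroup M] [Module R M] [AddCommGroup N] [Module R N]
  [AddCommGroup L] [Module R L]

/-- functoriality -/
noncomputable def hmap (f : M →ₗ[R] N) : HH J i M →ₗ[R] HH J i N := Hm J i (ModuleCat.ofHom f)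

lemma hmap_id : hmap J i (LinearMap.id : M →ₗ[R] M) = LinearMap.id := by
  unfold hmap Hm
  have : ModuleCat.ofHom (LinearMap.id : M →ₗ[R] M) = 𝟙 _ := rfl
  rw [this, CategoryTheory.Functor.map_id]; rfl

lemma hmap_comp (g : N →ₗ[R] L) (f : M →ₗ[R] N) :
    hmap J i (g ∘ₗ f) = hmap J i g ∘ₗ hmap J i f := by
  unfold hmap Hm
  have : ModuleCat.ofHom (g ∘ₗ f) = ModuleCat.ofHom f ≫ ModuleCat.ofHom g := rfl
  rw [this, Functor.map_comp]; rfl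

lemma hmap_comp_apply (g : N →ₗ[R] L) (f : M →ₗ[R] N) (x) :
    hmap J i (g ∘ₗ f) x = hmap J i g (hmap J i f x) := by rw [hmap_comp]; rfl

lemma hmap_add (f g : M →ₗ[R] N) : hmap J i (f + g) = hmap J i f + hmap J i g := by
  ext ξ
  obtain ⟨n, e, rfl⟩ := cmap_surj J i ξ
  have : ModuleCat.ofHom (f + g) = ModuleCat.ofHom f + ModuleCat.ofHom g := rfl
  rw [LinearMap.add_apply]
  unfold hmap
  rw [this, Hm_cmap, Hm_cmap, Hm_cmap, Abelian.Ext.mk₀_add, Abelian.Ext.comp_add, map_add]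

lemma hmap_smul (r : R) (f : M →ₗ[R] N) : hmap J i (r • f) = r • hmap J i f := by
  ext ξ
  obtain ⟨n, e, rfl⟩ := cmap_surj J i ξ
  have : ModuleCat.ofHom (r • f) = r • ModuleCat.ofHom f := rfl
  rw [LinearMap.smul_apply]
  unfold hmap
  rw [this, Hm_cmap, Hm_cmap, Abelian.Ext.mk₀_smul, Abelian.Ext.comp_smul, map_smul]

lemma hmap_zero : hmap J i (0 : M →ₗ[R] N) = 0 := by
  have := hmap_smul J i (0 : R) (0 : M →ₗ[R] N)
  simpa using this

/-- induced equivalence -/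
noncomputable def hEquiv (e : M ≃ₗ[R] N) : HH J i M ≃ₗ[R] HH J i N :=
  LinearEquiv.ofLinearMap (hmap J i (e : M →ₗ[R] N)) (hmap J i (e.symm : N →ₗ[R] M))
    (by rw [← hmap_comp]; simp [hmap_id]) (by rw [← hmap_comp]; simp [hmap_id])

end

/-- Short exact sequences. -/
structure SES {A B C : Type u} [AddCommGroup A] [Module R A] [AddCommGroup B] [Module R B]
    [AddCommGroup C] [Module R C] (f : A →ₗ[R] B) (g : B →ₗ[R] C) : Prop where
  inj : Function.Injective f
  exact : Function.Exact f g
  surj : Function.Surjective g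

section
variable {A B C : Type u} [AddCommGroup A] [Module R A] [AddCommGroup B] [Module R B]
    [AddCommGroup C] [Module R C] {f : A →ₗ[R] B} {g : B →ₗ[R] C} (h : SES f g)

/-- bundled version -/
noncomputable def SES.sc (h : SES f g) : ShortComplex (ModuleCat.{u} R) :=
  ShortComplex.mk (ModuleCat.ofHom f) (ModuleCat.ofHom g)
    (ModuleCat.hom_ext h.exact.linearMap_comp_eq_zero)

lemma SES.shortExact : h.sc.ShortExact where
  exact := (ShortComplex.ShortExact.moduleCat_exact_iff_function_exact _).2 h.exact
  mono_f := (ModuleCat.mono_iff_injective _).2 h.inj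
  epi_g := (ModuleCat.epi_iff_surjective _).2 h.surj

/-- the connecting class -/
noncomputable def SES.cls : Abelian.Ext.{u} (ModuleCat.of R C) (ModuleCat.of R A) 1 :=
  h.shortExact.extClass

variable (i : ℕ)

lemma ext_sub_comp {X Y Z : ModuleCat.{u} R} {a b c : ℕ} (x y : Abelian.Ext.{u} X Y a)
    (z : Abelian.Ext.{u} Y Z b) (hc : a + b = c) :
    (x - y).comp z hc = x.comp z hc - y.comp z hc := by
  rw [sub_eq_add_neg, Abelian.Ext.add_comp, Abelian.Ext.neg_comp, ← sub_eq_add_neg]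

lemma delta_wd {n n' : ℕ} (e : Abelian.Ext.{u} (RJ J n) (ModuleCat.of R C) i)
    (e' : Abelian.Ext.{u} (RJ J n') (ModuleCat.of R C) i)
    (he : cmap J i n _ e = cmap J i n' _ e') :
    cmap J (i+1) n _ (e.comp h.cls rfl) = cmap J (i+1) n' _ (e'.comp h.cls rfl) := by
  have h1 := cmap_trans J i (le_max_left n n') e
  have h2 := cmap_trans J i (le_max_right n n') e'
  rw [← cmap_trans J (i+1) (le_max_left n n') (e.comp h.cls rfl),
    ← cmap_trans J (i+1) (le_max_right n n') (e'.comp h.cls rfl)]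
  rw [← h1, ← h2, ← sub_eq_zero, ← map_sub] at he
  obtain ⟨k, hk, h0⟩ := cmap_eq_zero J i _ he
  rw [← sub_eq_zero, ← map_sub, ← cmap_trans J (i+1) hk]
  rw [← Abelian.Ext.comp_assoc (a₁₂ := i) _ _ _ (by omega) (by omega) (by omega),
    ← Abelian.Ext.comp_assoc (a₁₂ := i) _ _ _ (by omega) (by omega) (by omega),
    ← ext_sub_comp,
    ← Abelian.Ext.comp_assoc (a₁₂ := i) _ _ _ (by omega) (by omega) (by omega), h0]
  simp

/-- connecting homomorphism (underlying function) -/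
noncomputable def deltaFun (ξ : HH J i C) : HH J (i+1) A :=
  cmap J (i+1) (cmap_surj J i ξ).choose _
    ((cmap_surj J i ξ).choose_spec.choose.comp h.cls rfl)

lemma deltaFun_cmap {n : ℕ} (e : Abelian.Ext.{u} (RJ J n) (ModuleCat.of R C) i) :
    deltaFun J h i (cmap J i n _ e) = cmap J (i+1) n _ (e.comp h.cls rfl) := by
  apply delta_wd
  exact (cmap_surj J i _).choose_spec.choose_spec

lemma cmap_surj₂ {M N : ModuleCat.{u} R} (i j : ℕ) (ξ : H J i M) (η : H J j N) :
    ∃ n e e', cmap J i n M e = ξ ∧ cmap J j n N e' = η := by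
  obtain ⟨n, e, rfl⟩ := cmap_surj J i ξ
  obtain ⟨n', e', rfl⟩ := cmap_surj J j η
  exact ⟨max n n', _, _, cmap_trans J i (le_max_left n n') e, cmap_trans J j (le_max_right n n') e'⟩

/-- connecting homomorphism -/
noncomputable def delta : HH J i C →ₗ[R] HH J (i+1) A where
  toFun := deltaFun J h i
  map_add' ξ η := by
    obtain ⟨n, e, e', rfl, rfl⟩ := cmap_surj₂ J i i ξ η
    rw [← map_add, deltaFun_cmap, deltaFun_cmap, deltaFun_cmap, Abelian.Ext.add_comp, map_add]
  map_smul' r ξ := by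
    obtain ⟨n, e, rfl⟩ := cmap_surj J i ξ
    rw [← map_smul, deltaFun_cmap, deltaFun_cmap, Abelian.Ext.smul_comp, map_smul]; rfl

lemma delta_cmap {n : ℕ} (e : Abelian.Ext.{u} (RJ J n) (ModuleCat.of R C) i) :
    delta J h i (cmap J i n _ e) = cmap J (i+1) n _ (e.comp h.cls rfl) := deltaFun_cmap J h i e

lemma hmap_cmap {n : ℕ} (e : Abelian.Ext.{u} (RJ J n) (ModuleCat.of R A) i) :
    hmap J i f (cmap J i n _ e) = cmap J i n _ (e.comp (.mk₀ (ModuleCat.ofHom f)) (add_zero i)) :=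
  Hm_cmap J i _ e

lemma hex2 (h : SES f g) (i : ℕ) (y : HH J i B) (hy : hmap J i g y = 0) : ∃ x, hmap J i f x = y := by
  obtain ⟨n, e, rfl⟩ := cmap_surj J i y
  rw [hmap_cmap] at hy
  obtain ⟨k, hk, h0⟩ := cmap_eq_zero J i _ hy
  rw [← Abelian.Ext.comp_assoc (a₁₂ := i) _ _ _ (by omega) (by omega) (by omega)] at h0
  obtain ⟨x, hx⟩ := Abelian.Ext.covariant_sequence_exact₂ _ h.shortExact _ h0
  refine ⟨cmap J i k _ x, ?_⟩
  rw [← cmap_trans J i hk e]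
  exact (hmap_cmap J i _).trans (congrArg _ hx)

lemma hex3 (z : HH J i C) (hz : delta J h i z = 0) : ∃ y, hmap J i g y = z := by
  obtain ⟨n, e, rfl⟩ := cmap_surj J i z
  rw [delta_cmap] at hz
  obtain ⟨k, hk, h0⟩ := cmap_eq_zero J (i+1) _ hz
  rw [← Abelian.Ext.comp_assoc (a₁₂ := i) _ _ _ (by omega) (by omega) (by omega)] at h0
  obtain ⟨x, hx⟩ := Abelian.Ext.covariant_sequence_exact₃ _ h.shortExact _ rfl h0
  refine ⟨cmap J i k _ x, ?_⟩
  rw [← cmap_trans J i hk e]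
  exact (hmap_cmap J i _).trans (congrArg _ hx)

lemma hex1 (x : HH J (i+1) A) (hx : hmap J (i+1) f x = 0) : ∃ z, delta J h i z = x := by
  obtain ⟨n, e, rfl⟩ := cmap_surj J (i+1) x
  rw [hmap_cmap] at hx
  obtain ⟨k, hk, h0⟩ := cmap_eq_zero J (i+1) _ hx
  rw [← Abelian.Ext.comp_assoc (a₁₂ := i+1) _ _ _ (by omega) (by omega) (by omega)] at h0
  obtain ⟨x, hx⟩ := Abelian.Ext.covariant_sequence_exact₁ _ h.shortExact _ h0 rfl
  refine ⟨cmap J i k _ x, ?_⟩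
  rw [← cmap_trans J (i+1) hk e]
  exact (delta_cmap J h i _).trans (congrArg _ hx)

lemma delta_hmap (y : HH J i B) : delta J h i (hmap J i g y) = 0 := by
  obtain ⟨n, e, rfl⟩ := cmap_surj J i y
  rw [hmap_cmap, delta_cmap, Abelian.Ext.comp_assoc (a₂₃ := 1) _ _ _ (by omega) (by omega) (by omega)]
  have : (Abelian.Ext.mk₀ (ModuleCat.ofHom g)).comp h.cls (zero_add 1) = 0 :=
    h.shortExact.comp_extClass
  rw [this]
  simp

lemma hmap_delta (z : HH J i C) : hmap J (i+1) f (delta J h i z) = 0 := by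
  obtain ⟨n, e, rfl⟩ := cmap_surj J i z
  rw [delta_cmap, hmap_cmap, Abelian.Ext.comp_assoc (a₂₃ := 1) _ _ _ (by omega) (by omega) (by omega)]
  have : h.cls.comp (Abelian.Ext.mk₀ (ModuleCat.ofHom f)) (add_zero 1) = 0 :=
    h.shortExact.extClass_comp
  rw [this]
  simp

lemma hmap_hmap (h : SES f g) (i : ℕ) (x : HH J i A) : hmap J i g (hmap J i f x) = 0 := by
  rw [← hmap_comp_apply, h.exact.linearMap_comp_eq_zero, hmap_zero]; rfl

lemma hmap_inj_zero (hf : Function.Injective f) : Function.Injective (hmap J 0 f) := by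
  rw [← LinearMap.ker_eq_bot, LinearMap.ker_eq_bot']
  intro x hx
  obtain ⟨n, e, rfl⟩ := cmap_surj J 0 x
  rw [hmap_cmap] at hx
  obtain ⟨k, hk, h0⟩ := cmap_eq_zero J 0 _ hx
  rw [← Abelian.Ext.comp_assoc (a₁₂ := 0) _ _ _ (by omega) (by omega) (by omega)] at h0
  have : Mono (ModuleCat.ofHom f) := (ModuleCat.mono_iff_injective _).2 hf
  have h3 := Abelian.Ext.postcomp_mk₀_injective_of_mono (RJ J k) (ModuleCat.ofHom f)
  have h2 := h3 (a₁ := (Abelian.Ext.mk₀ (prj J hk)).comp e (zero_add 0)) (a₂ := 0)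
    (by rw [map_zero]; exact h0)
  rw [← cmap_trans J 0 hk e, h2, map_zero]

variable {A' B' C' : Type u} [AddCommGroup A'] [Module R A'] [AddCommGroup B'] [Module R B']
    [AddCommGroup C'] [Module R C'] {f' : A' →ₗ[R] B'} {g' : B' →ₗ[R] C'} (h' : SES f' g')

lemma delta_nat (a : A →ₗ[R] A') (b : B →ₗ[R] B') (c : C →ₗ[R] C')
    (hab : b ∘ₗ f = f' ∘ₗ a) (hbc : c ∘ₗ g = g' ∘ₗ b) (z : HH J i C) :
    hmap J (i+1) a (delta J h i z) = delta J h' i (hmap J i c z) := by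
  obtain ⟨n, e, rfl⟩ := cmap_surj J i z
  rw [hmap_cmap, delta_cmap, delta_cmap, hmap_cmap,
    Abelian.Ext.comp_assoc (a₂₃ := 1) _ _ _ (by omega) (by omega) (by omega),
    Abelian.Ext.comp_assoc (a₂₃ := 1) _ _ _ (by omega) (by omega) (by omega)]
  let φ : h.sc ⟶ h'.sc :=
    { τ₁ := ModuleCat.ofHom a, τ₂ := ModuleCat.ofHom b, τ₃ := ModuleCat.ofHom c
      comm₁₂ := ModuleCat.hom_ext hab.symm
      comm₂₃ := ModuleCat.hom_ext hbc.symm }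
  have := ShortComplex.ShortExact.extClass_naturality h.shortExact h'.shortExact φ
  have h2 : h.cls.comp (Abelian.Ext.mk₀ (ModuleCat.ofHom a)) (add_zero 1) =
    (Abelian.Ext.mk₀ (ModuleCat.ofHom c)).comp h'.cls (zero_add 1) := this
  rw [h2]
end
end LC
end part5

section part6
open CategoryTheory Opposite Limits
namespace LC
variable {R : Type u} [CommRing R] (J : Ideal R)
variable {M N : Type u} [AddCommGroup M] [Module R M] [AddCommGroup N] [Module R N]

lemma ext_smul_zero {X Y : ModuleCat.{u} R} {i : ℕ} (r : R) (hr : r • 𝟙 X = 0)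
    (e : Abelian.Ext.{u} X Y i) : r • e = 0 := by
  have : e = (Abelian.Ext.mk₀ (𝟙 X)).comp e (zero_add i) := by simp
  rw [this, ← Abelian.Ext.smul_comp, ← Abelian.Ext.mk₀_smul, hr]
  simp

lemma RJ_smul (n : ℕ) {r : R} (hr : r ∈ J ^ n) : r • 𝟙 (RJ J n) = 0 := by
  refine ModuleCat.hom_ext (LinearMap.ext fun x => ?_)
  change r • x = 0
  obtain ⟨y, rfl⟩ := Ideal.Quotient.mk_surjective x
  change Ideal.Quotient.mk (J ^ n) (r * y) = 0
  rw [Ideal.Quotient.eq_zero_iff_mem]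
  exact Ideal.mul_mem_right _ _ hr

/-- `J`-power torsion modules -/
def IsTors (M : Type u) [AddCommGroup M] [Module R M] : Prop :=
  ∀ x : M, ∃ n : ℕ, ∀ r ∈ J ^ n, r • x = 0

lemma HH_tors (i : ℕ) : IsTors J (HH J i M) := by
  intro ξ
  obtain ⟨n, e, rfl⟩ := cmap_surj J i ξ
  refine ⟨n, fun r hr => ?_⟩
  rw [← map_smul, ext_smul_zero r (RJ_smul J n hr), map_zero]

/-- evaluation at one -/
noncomputable def ev1 {n : ℕ} (e : Abelian.Ext.{u} (RJ J n) (ModuleCat.of R M) 0) : M :=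
  (Abelian.Ext.homEquiv₀ e).hom (Ideal.Quotient.mk (J ^ n) 1)

lemma ev1_mk₀ {n : ℕ} (φ : RJ J n ⟶ ModuleCat.of R M) :
    ev1 J (Abelian.Ext.mk₀ φ) = φ.hom (Ideal.Quotient.mk (J ^ n) 1) := by
  have : Abelian.Ext.homEquiv₀ (Abelian.Ext.mk₀ φ) = φ := Abelian.Ext.homEquiv₀.apply_symm_apply φ
  unfold ev1
  rw [this]

lemma exists_mk₀ {X Y : ModuleCat.{u} R} (e : Abelian.Ext.{u} X Y 0) :
    ∃ φ, Abelian.Ext.mk₀ φ = e := ⟨_, Abelian.Ext.mk₀_homEquiv₀_apply e⟩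

lemma RJ_ext {n : ℕ} (φ : RJ J n ⟶ ModuleCat.of R M) (h : φ.hom (Ideal.Quotient.mk (J ^ n) 1) = 0) :
    φ = 0 := by
  refine ModuleCat.hom_ext (LinearMap.ext fun x => ?_)
  obtain ⟨y, rfl⟩ := Ideal.Quotient.mk_surjective x
  have : Ideal.Quotient.mk (J ^ n) y = y • Ideal.Quotient.mk (J ^ n) 1 := by
    change _ = Ideal.Quotient.mk (J ^ n) (y * 1)
    simp
  rw [this, map_smul, h]
  simp

lemma ev1_eq_zero {n : ℕ} (e : Abelian.Ext.{u} (RJ J n) (ModuleCat.of R M) 0) (h : ev1 J e = 0) :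
    e = 0 := by
  obtain ⟨φ, rfl⟩ := exists_mk₀ e
  rw [ev1_mk₀] at h
  rw [RJ_ext J φ h]; simp

lemma ev1_add {n : ℕ} (e e' : Abelian.Ext.{u} (RJ J n) (ModuleCat.of R M) 0) :
    ev1 J (e + e') = ev1 J e + ev1 J e' := by
  obtain ⟨φ, rfl⟩ := exists_mk₀ e
  obtain ⟨φ', rfl⟩ := exists_mk₀ e'
  rw [← Abelian.Ext.mk₀_add, ev1_mk₀, ev1_mk₀, ev1_mk₀]; rfl

lemma ev1_smul {n : ℕ} (r : R) (e : Abelian.Ext.{u} (RJ J n) (ModuleCat.of R M) 0) :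
    ev1 J (r • e) = r • ev1 J e := by
  obtain ⟨φ, rfl⟩ := exists_mk₀ e
  rw [← Abelian.Ext.mk₀_smul, ev1_mk₀, ev1_mk₀]; rfl

lemma ev1_map {n : ℕ} (f : M →ₗ[R] N) (e : Abelian.Ext.{u} (RJ J n) (ModuleCat.of R M) 0) :
    ev1 J (e.comp (Abelian.Ext.mk₀ (ModuleCat.ofHom f)) (add_zero 0)) = f (ev1 J e) := by
  obtain ⟨φ, rfl⟩ := exists_mk₀ e
  rw [Abelian.Ext.mk₀_comp_mk₀, ev1_mk₀, ev1_mk₀]; rfl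

lemma ev1_prj {n k : ℕ} (h : n ≤ k) (e : Abelian.Ext.{u} (RJ J n) (ModuleCat.of R M) 0) :
    ev1 J ((Abelian.Ext.mk₀ (prj J h)).comp e (zero_add 0)) = ev1 J e := by
  obtain ⟨φ, rfl⟩ := exists_mk₀ e
  rw [Abelian.Ext.mk₀_comp_mk₀, ev1_mk₀, ev1_mk₀]; rfl

lemma ev1_wd {n n' : ℕ} (e : Abelian.Ext.{u} (RJ J n) (ModuleCat.of R M) 0)
    (e' : Abelian.Ext.{u} (RJ J n') (ModuleCat.of R M) 0)
    (he : cmap J 0 n _ e = cmap J 0 n' _ e') : ev1 J e = ev1 J e' := by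
  have h1 := cmap_trans J 0 (le_max_left n n') e
  have h2 := cmap_trans J 0 (le_max_right n n') e'
  rw [← h1, ← h2, ← sub_eq_zero, ← map_sub] at he
  obtain ⟨k, hk, h0⟩ := cmap_eq_zero J 0 _ he
  have h3 := ev1_prj J hk ((Abelian.Ext.mk₀ (prj J (le_max_left n n'))).comp e (zero_add 0) -
    (Abelian.Ext.mk₀ (prj J (le_max_right n n'))).comp e' (zero_add 0))
  rw [h0] at h3
  have h4 : ev1 J (0 : Abelian.Ext.{u} (RJ J k) (ModuleCat.of R M) 0) = 0 := by
    simpa using ev1_smul J (0:R) (0 : Abelian.Ext.{u} (RJ J k) (ModuleCat.of R M) 0)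
  rw [h4] at h3
  have h5 := ev1_add J ((Abelian.Ext.mk₀ (prj J (le_max_left n n'))).comp e (zero_add 0) -
    (Abelian.Ext.mk₀ (prj J (le_max_right n n'))).comp e' (zero_add 0))
      ((Abelian.Ext.mk₀ (prj J (le_max_right n n'))).comp e' (zero_add 0))
  rw [sub_add_cancel, ← h3, ev1_prj, ev1_prj, zero_add] at h5
  exact h5

/-- The comparison map `H^0_J(M) → M`. -/
noncomputable def ev : HH J 0 M →ₗ[R] M where
  toFun ξ := ev1 J (cmap_surj J 0 ξ).choose_spec.choose
  map_add' ξ η := by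
    obtain ⟨n, e, e', rfl, rfl⟩ := cmap_surj₂ J 0 0 ξ η
    rw [← ev1_wd J _ _ (cmap_surj J 0 (cmap J 0 n _ e)).choose_spec.choose_spec.symm,
      ← ev1_wd J _ _ (cmap_surj J 0 (cmap J 0 n _ e')).choose_spec.choose_spec.symm, ← ev1_add]
    apply ev1_wd
    rw [(cmap_surj J 0 _).choose_spec.choose_spec, map_add]
  map_smul' r ξ := by
    obtain ⟨n, e, rfl⟩ := cmap_surj J 0 ξ
    rw [← ev1_wd J _ _ (cmap_surj J 0 (cmap J 0 n _ e)).choose_spec.choose_spec.symm]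
    rw [RingHom.id_apply, ← ev1_smul]
    apply ev1_wd
    rw [(cmap_surj J 0 _).choose_spec.choose_spec, map_smul]

lemma ev_cmap {n : ℕ} (e : Abelian.Ext.{u} (RJ J n) (ModuleCat.of R M) 0) :
    ev J (cmap J 0 n _ e) = ev1 J e :=
  ev1_wd J _ _ (cmap_surj J 0 (cmap J 0 n _ e)).choose_spec.choose_spec

lemma ev_inj : Function.Injective (ev J : HH J 0 M →ₗ[R] M) := by
  rw [← LinearMap.ker_eq_bot, LinearMap.ker_eq_bot']
  intro x hx
  obtain ⟨n, e, rfl⟩ := cmap_surj J 0 x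
  rw [ev_cmap] at hx
  rw [ev1_eq_zero J e hx, map_zero]

lemma ev_surj (n : ℕ) (x : M) (hx : ∀ r ∈ J ^ n, r • x = 0) : ∃ ξ : HH J 0 M, ev J ξ = x := by
  let φ : (R ⧸ J ^ n) →ₗ[R] M := (J ^ n).liftQ (LinearMap.toSpanSingleton R M x)
    (fun r hr => by simpa using hx r hr)
  refine ⟨cmap J 0 n _ (.mk₀ (ModuleCat.ofHom φ)), ?_⟩
  rw [ev_cmap, ev1_mk₀]
  exact (Submodule.liftQ_apply (J ^ n) (LinearMap.toSpanSingleton R M x) 1).trans (by simp)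

lemma ev_hmap (f : M →ₗ[R] N) (ξ : HH J 0 M) : ev J (hmap J 0 f ξ) = f (ev J ξ) := by
  obtain ⟨n, e, rfl⟩ := cmap_surj J 0 ξ
  rw [hmap_cmap, ev_cmap, ev_cmap, ev1_map]

lemma ev_tors (ξ : HH J 0 M) : ∃ n : ℕ, ∀ r ∈ J ^ n, r • ev J ξ = 0 := by
  obtain ⟨n, h⟩ := HH_tors J 0 ξ
  exact ⟨n, fun r hr => by rw [← map_smul, h r hr, map_zero]⟩

lemma HH_injective [Module.Injective R M] (i : ℕ) (ξ : HH J (i+1) M) : ξ = 0 := by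
  obtain ⟨n, e, rfl⟩ := cmap_surj J (i+1) ξ
  have : Injective (ModuleCat.of R M) := Module.injective_object_of_injective_module R M
  rw [Abelian.Ext.eq_zero_of_injective e, map_zero]

variable (M) in
/-- the torsion submodule -/
def Gam : Submodule R M where
  carrier := {x | ∃ n : ℕ, ∀ r ∈ J ^ n, r • x = 0}
  add_mem' := by
    rintro x y ⟨n, hn⟩ ⟨k, hk⟩
    refine ⟨max n k, fun r hr => ?_⟩
    rw [smul_add, hn r (Ideal.pow_le_pow_right (le_max_left n k) hr),
      hk r (Ideal.pow_le_pow_right (le_max_right n k) hr), add_zero]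
  zero_mem' := ⟨0, by simp⟩
  smul_mem' := by
    rintro a x ⟨n, hn⟩
    exact ⟨n, fun r hr => by rw [smul_comm, hn r hr, smul_zero]⟩

lemma Gam_tors : IsTors J (Gam J M) := by
  rintro ⟨x, n, hn⟩
  exact ⟨n, fun r hr => Subtype.ext (hn r hr)⟩

lemma Gam_injective [IsNoetherianRing R] [Module.Injective R M] : Module.Injective R (Gam J M) := by
  apply Module.Baer.injective
  intro I φ
  -- φ(I) is killed by some J^s
  have hs : ∃ s : ℕ, ∀ x : I, ∀ r ∈ J ^ s, r • φ x = 0 := by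
    have hfg : (⊤ : Submodule R I).FG := Module.Finite.fg_top
    obtain ⟨S, hS⟩ := hfg
    choose n hn using fun x : I => Gam_tors J (φ x)
    refine ⟨S.sup n, fun x r hr => ?_⟩
    have hx : x ∈ Submodule.span R (S : Set I) := hS ▸ Submodule.mem_top
    induction hx using Submodule.span_induction with
    | mem x hx => exact hn x r (Ideal.pow_le_pow_right (Finset.le_sup hx) hr)
    | zero => simp
    | add x y _ _ h1 h2 => rw [map_add, smul_add, h1, h2, add_zero]
    | smul a x _ h1 => rw [map_smul, smul_comm, h1, smul_zero]
  obtain ⟨s, hs⟩ := hs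
  obtain ⟨k, hk⟩ := J.exists_pow_inf_eq_pow_smul (I : Submodule R R)
  have hk2 := hk (k + s) (by omega)
  have hker : Submodule.comap I.subtype (J ^ (k+s)) ≤ LinearMap.ker ((Gam J M).subtype ∘ₗ φ) := by
    intro x hx
    have h1 : (x : R) ∈ (J ^ (k+s) • ⊤ ⊓ I : Submodule R R) := by
      refine ⟨?_, x.2⟩
      have : (x : R) ∈ J ^ (k+s) := hx
      simpa using this
    rw [hk2] at h1
    have h2 : (x : R) ∈ (J ^ s • I : Submodule R R) := by
      have : k + s - k = s := by omega
      rw [this] at h1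
      exact Submodule.smul_mono le_rfl inf_le_right h1
    have h3 : ∀ y ∈ (J ^ s • I : Submodule R R), ∃ hy : y ∈ I, φ ⟨y, hy⟩ = 0 := by
      intro y hy
      induction hy using Submodule.smul_induction_on' with
      | smul r hr n hn =>
        refine ⟨I.smul_mem r hn, ?_⟩
        have : (⟨r • n, I.smul_mem r hn⟩ : I) = r • ⟨n, hn⟩ := rfl
        rw [this, map_smul, hs _ r hr]
      | add a _ b _ ha hb =>
        obtain ⟨ha, ha'⟩ := ha
        obtain ⟨hb, hb'⟩ := hb
        refine ⟨I.add_mem ha hb, ?_⟩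
        have : (⟨a + b, I.add_mem ha hb⟩ : I) = ⟨a, ha⟩ + ⟨b, hb⟩ := rfl
        rw [this, map_add, ha', hb', add_zero]
    obtain ⟨hy, h4⟩ := h3 x h2
    rw [LinearMap.mem_ker, LinearMap.comp_apply]
    have : (⟨(x : R), hy⟩ : I) = x := rfl
    rw [this] at h4
    rw [h4, map_zero]
  let g := Submodule.liftQ (Submodule.comap I.subtype (J ^ (k+s))) ((Gam J M).subtype ∘ₗ φ) hker
  let ι := Submodule.mapQ (Submodule.comap I.subtype (J ^ (k+s))) (J ^ (k+s)) I.subtype le_rfl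
  have hι : Function.Injective ι := by
    rw [← LinearMap.ker_eq_bot]
    unfold ι
    rw [Submodule.mapQ, Submodule.ker_liftQ_eq_bot]
    rw [LinearMap.ker_comp, Submodule.ker_mkQ]
  obtain ⟨h, hh⟩ := Module.Injective.out ι hι g
  have htors : ∀ q, h q ∈ Gam J M := by
    intro q
    refine ⟨k + s, fun r hr => ?_⟩
    have : r • q = 0 := by
      have := congrArg (fun t => t.hom q) (RJ_smul J (k+s) hr)
      exact this
    rw [← map_smul, this, map_zero]
  refine ⟨(h.codRestrict (Gam J M) htors) ∘ₗ (J ^ (k+s)).mkQ, fun x mem => ?_⟩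
  apply Subtype.ext
  exact hh (Submodule.Quotient.mk ⟨x, mem⟩)

lemma exists_embed (M : Type u) [AddCommGroup M] [Module R M] :
    ∃ (E : Type u) (_ : AddCommGroup E) (_ : Module R E) (_ : Module.Injective R E)
      (f : M →ₗ[R] E), Function.Injective f := by
  let E := Injective.under (ModuleCat.of R M)
  have h : Module.Injective R E := by
    have : Injective (ModuleCat.of R E) := inferInstanceAs (Injective E)
    exact Module.injective_module_of_injective_object R E
  exact ⟨E, inferInstance, inferInstance, h, (Injective.ι (ModuleCat.of R M)).hom,
    (ModuleCat.mono_iff_injective _).1 inferInstance⟩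

lemma SES.mkQ {f : M →ₗ[R] N} (hf : Function.Injective f) : SES f (LinearMap.range f).mkQ :=
  ⟨hf, LinearMap.exact_map_mkQ_range f, Submodule.mkQ_surjective _⟩

lemma SES.sub (P : Submodule R M) : SES P.subtype P.mkQ :=
  ⟨P.injective_subtype, LinearMap.exact_subtype_mkQ P, Submodule.mkQ_surjective _⟩

theorem HH_of_tors [IsNoetherianRing R] (i : ℕ) : ∀ (M : Type u) [AddCommGroup M] [Module R M],
    IsTors J M → ∀ ξ : HH J (i+1) M, ξ = 0 := by
  induction i with
  | zero =>
    intro M _ _ hM ξ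
    obtain ⟨E, _, _, hE, f, hf⟩ := exists_embed (R := R) M
    have := Gam_injective J (M := E)
    let f' : M →ₗ[R] Gam J E := f.codRestrict _ (fun x => by
      obtain ⟨n, hn⟩ := hM x
      exact ⟨n, fun r hr => by rw [← map_smul, hn r hr, map_zero]⟩)
    have hf' : Function.Injective f' := fun a b h => hf (congrArg Subtype.val h)
    have hs := SES.mkQ hf'
    obtain ⟨z, rfl⟩ := hex1 J hs 0 ξ (HH_injective J 0 _)
    obtain ⟨y, hy⟩ := hs.surj (ev J z)
    obtain ⟨n, hn⟩ := Gam_tors J y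
    obtain ⟨η, rfl⟩ := ev_surj J n y hn
    rw [← ev_hmap] at hy
    rw [← ev_inj J hy, delta_hmap]
  | succ i ih =>
    intro M _ _ hM ξ
    obtain ⟨E, _, _, hE, f, hf⟩ := exists_embed (R := R) M
    have := Gam_injective J (M := E)
    let f' : M →ₗ[R] Gam J E := f.codRestrict _ (fun x => by
      obtain ⟨n, hn⟩ := hM x
      exact ⟨n, fun r hr => by rw [← map_smul, hn r hr, map_zero]⟩)
    have hf' : Function.Injective f' := fun a b h => hf (congrArg Subtype.val h)
    have hs := SES.mkQ hf'
    obtain ⟨z, rfl⟩ := hex1 J hs _ ξ (HH_injective J _ _)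
    rw [ih _ ?_ z, map_zero]
    intro q
    obtain ⟨y, rfl⟩ := hs.surj q
    obtain ⟨n, hn⟩ := Gam_tors J y
    exact ⟨n, fun r hr => by rw [← map_smul, hn r hr, map_zero]⟩

end LC
end part6

section part7
set_option linter.unusedSectionVars false
namespace LC
open IsLocalRing Module

section alg
variable {R : Type u} [CommRing R] {M N : Type u} [AddCommGroup M] [Module R M] [AddCommGroup N] [Module R N]

/-- quotient by a single element -/
abbrev Q (y : R) (M : Type u) [AddCommGroup M] [Module R M] := M ⧸ (Ideal.span {y} • ⊤ : Submodule R M)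

theorem map_smul_top_equiv (e : M ≃ₗ[R] N) (I : Ideal R) :
    (I • ⊤ : Submodule R M).map (e : M →ₗ[R] N) = I • ⊤ := by
  rw [Submodule.map_smul'', Submodule.map_top, LinearEquiv.range]

noncomputable def quotEquiv (e : M ≃ₗ[R] N) (I : Ideal R) :
    (M ⧸ (I • ⊤ : Submodule R M)) ≃ₗ[R] (N ⧸ (I • ⊤ : Submodule R N)) :=
  Submodule.Quotient.equiv _ _ e (map_smul_top_equiv e I)

noncomputable def quotBot (I : Ideal R) (h : I = ⊥) : (M ⧸ (I • ⊤ : Submodule R M)) ≃ₗ[R] M :=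
  Submodule.quotEquivOfEqBot _ (by rw [h, Submodule.bot_smul])

noncomputable def quotSup (a b c : Ideal R) (h : c = a ⊔ b) :
    ((M ⧸ (a • ⊤ : Submodule R M)) ⧸ (b • ⊤ : Submodule R (M ⧸ (a • ⊤ : Submodule R M)))) ≃ₗ[R]
      (M ⧸ (c • ⊤ : Submodule R M)) :=
  (Submodule.quotEquivOfEq _ _ (by
    subst h
    rw [Submodule.sup_smul, Submodule.map_sup]
    have h1 : (a • ⊤ : Submodule R M).map (a • ⊤ : Submodule R M).mkQ = ⊥ :=
      Submodule.mkQ_map_self _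
    rw [h1, bot_sup_eq, Submodule.map_smul'', Submodule.map_top, Submodule.range_mkQ])).trans
  (Submodule.quotientQuotientEquivQuotient (a • ⊤ : Submodule R M) (c • ⊤)
    (Submodule.smul_mono_left (h ▸ le_sup_left)))

end alg

section loc
variable {R : Type u} [CommRing R] [IsLocalRing R] {M N : Type u} [AddCommGroup M] [Module R M] [AddCommGroup N] [Module R N]

theorem fl_congr (e : M ≃ₗ[R] N) : IsFiniteLength R M ↔ IsFiniteLength R N :=
  ⟨fun h => h.of_surjective (f := (e : M →ₗ[R] N)) e.surjective, fun h => h.of_injective (f := (e : M →ₗ[R] N)) e.injective⟩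

theorem sop_congr (e : M ≃ₗ[R] N) (d) (x : Fin d → R) : Paper.IsSOP R M d x ↔ Paper.IsSOP R N d x :=
  and_congr_right fun _ => fl_congr (quotEquiv e _)

theorem ann_torsionBy_congr (e : M ≃ₗ[R] N) (y : R) :
    Module.annihilator R (Submodule.torsionBy R M y) = Module.annihilator R (Submodule.torsionBy R N y) := by
  ext a
  simp only [Module.mem_annihilator, Subtype.forall, Submodule.mem_torsionBy_iff]
  constructor
  · intro h n hn
    have := h (e.symm n) (by rw [← map_smul, hn, map_zero])
    apply Subtype.ext
    have h2 := congrArg (fun z => e z.1) this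
    simpa using h2
  · intro h n hn
    have := h (e n) (by rw [← map_smul, hn, map_zero])
    apply Subtype.ext
    have h2 := congrArg (fun z => e.symm z.1) this
    simpa using h2

theorem bIdeal_congr (e : M ≃ₗ[R] N) (d) : Paper.bIdeal R M d = Paper.bIdeal R N d := by
  unfold Paper.bIdeal
  refine iInf_congr fun x => iInf_congr_Prop (sop_congr e d x) fun _ => iInf_congr fun i => ?_
  exact ann_torsionBy_congr (quotEquiv e _) _

theorem mem_bIdeal {d} {a : R} : a ∈ Paper.bIdeal R M d ↔ ∀ x, Paper.IsSOP R M d x → ∀ i : Fin d,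
    a ∈ Module.annihilator R
      (Submodule.torsionBy R (M ⧸ (Ideal.span (x '' {j | j < i}) • ⊤ : Submodule R M)) (x i)) := by
  simp [Paper.bIdeal, Submodule.mem_iInf]

theorem sop_cons {d} (y : R) (s : Fin d → R) :
    Paper.IsSOP R M (d+1) (Fin.cons y s : Fin (d+1) → R) ↔ y ∈ maximalIdeal R ∧ Paper.IsSOP R (Q y M) d s := by
  unfold Paper.IsSOP
  have := fl_congr (quotSup (M := M) (Ideal.span {y}) (Ideal.span (Set.range s))
    (Ideal.span (Set.range (Fin.cons y s : Fin (d+1) → R))) (by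
      rw [Fin.range_cons, Set.insert_eq, Ideal.span_union]))
  rw [← this, Fin.forall_fin_succ]
  simp [and_assoc]

theorem range_snoc' {d} (x : Fin (d+1) → R) : Set.range x = {x (Fin.last d)} ∪ Set.range (Fin.init x) := by
  ext r
  simp only [Set.mem_range, Fin.exists_fin_succ', Set.mem_union, Set.mem_singleton_iff, Fin.init]
  rw [or_comm, eq_comm]

theorem span_last {d} (x : Fin (d+1) → R) : Ideal.span (Set.range x) =
    Ideal.span {x (Fin.last d)} ⊔ Ideal.span (Set.range (Fin.init x)) := by
  rw [range_snoc', Ideal.span_union]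

theorem sop_last {d} (x : Fin (d+1) → R) :
    Paper.IsSOP R M (d+1) x ↔ x (Fin.last d) ∈ maximalIdeal R ∧
      Paper.IsSOP R (Q (x (Fin.last d)) M) d (Fin.init x) := by
  unfold Paper.IsSOP
  have := fl_congr (quotSup (M := M) (Ideal.span {x (Fin.last d)}) (Ideal.span (Set.range (Fin.init x)))
    (Ideal.span (Set.range x)) (span_last x))
  rw [← this, Fin.forall_fin_succ']
  simp only [Fin.init]
  tauto

theorem csop_last {d} (x : Fin (d+1) → R) (h : Paper.IsCSOP R M (d+1) x) :
    x (Fin.last d) ∈ (Paper.bIdeal R M (d+1))^3 ∧ Paper.IsCSOP R (Q (x (Fin.last d)) M) d (Fin.init x) := by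
  obtain ⟨h1, h2⟩ := h
  refine ⟨?_, ((sop_last x).1 h1).2, fun i => ?_⟩
  · have := h2 (Fin.last d)
    rwa [bIdeal_congr (quotBot _ (by
      rw [show {j : Fin (d+1) | Fin.last d < j} = ∅ by
        ext j; simp [Fin.le_last], Set.image_empty, Ideal.span_empty]))] at this
  · have := h2 i.castSucc
    rw [← bIdeal_congr (quotSup (Ideal.span {x (Fin.last d)}) (Ideal.span (Fin.init x '' {j | i < j})) _ (by
      rw [← Ideal.span_union]; congr 1
      ext r
      simp only [Set.mem_image, Set.mem_ofPred_eq, Fin.exists_fin_succ', Set.mem_union, Set.mem_singleton_iff, Fin.init]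
      simp only [Fin.castSucc_lt_castSucc_iff, Fin.castSucc_lt_last, true_and]
      rw [or_comm, eq_comm]))] at this
    exact this

theorem B1' {d} {a y : R} (ha : a ∈ Paper.bIdeal R M (d+1)) (hy : y ∈ maximalIdeal R) (s : Fin d → R)
    (hs : Paper.IsSOP R (Q y M) d s) (u : M) (hu : y • u = 0) : a • u = 0 := by
  have := mem_bIdeal.1 ha _ ((sop_cons y s).2 ⟨hy, hs⟩) 0
  rw [ann_torsionBy_congr (quotBot _ (by simp))] at this
  rw [Module.mem_annihilator] at this
  exact congrArg Subtype.val (this ⟨u, by simpa using hu⟩)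

theorem B2 {d} {a y : R} (ha : a ∈ Paper.bIdeal R M (d+1)) (hy : y ∈ maximalIdeal R) :
    a ∈ Paper.bIdeal R (Q y M) d := by
  rw [mem_bIdeal]
  intro s hs i
  have := mem_bIdeal.1 ha _ ((sop_cons y s).2 ⟨hy, hs⟩) i.succ
  rw [← ann_torsionBy_congr (quotSup (Ideal.span {y}) (Ideal.span (s '' {j | j < i})) _ (by
      rw [← Ideal.span_union]; congr 1
      ext r
      simp only [Set.mem_image, Set.mem_ofPred_eq, Fin.exists_fin_succ, Set.mem_union, Set.mem_singleton_iff]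
      simp [eq_comm]))] at this
  exact this

theorem ir_last {d} (x : Fin (d+1) → R) :
    Nonempty ((Q (x (Fin.last d)) M ⧸ (Ideal.span (Set.range (Fin.init x)) • ⊤ : Submodule R (Q (x (Fin.last d)) M)))
      ≃ₗ[R] (M ⧸ (Ideal.span (Set.range x) • ⊤ : Submodule R M))) :=
  ⟨quotSup _ _ _ (span_last x)⟩

noncomputable def torsionEquiv (I : Ideal R) (e : M ≃ₗ[R] N) :
    Submodule.torsionBySet R M (I : Set R) ≃ₗ[R ⧸ I] Submodule.torsionBySet R N (I : Set R) where
  toFun z := ⟨e z.1, by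
    have := z.2
    rw [Submodule.mem_torsionBySet_iff] at this ⊢
    intro r; rw [← map_smul, this r, map_zero]⟩
  invFun z := ⟨e.symm z.1, by
    have := z.2
    rw [Submodule.mem_torsionBySet_iff] at this ⊢
    intro r; rw [← map_smul, this r, map_zero]⟩
  left_inv z := by simp
  right_inv z := by simp
  map_add' a b := by ext; simp
  map_smul' r z := by
    obtain ⟨r, rfl⟩ := Ideal.Quotient.mk_surjective r
    ext
    exact e.map_smul r z.1

theorem socDim_congr (I : Ideal R) (e : M ≃ₗ[R] N) : Paper.socDim R I M = Paper.socDim R I N :=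
  (torsionEquiv I e).finrank_eq

theorem ir_eq {d} (x : Fin (d+1) → R) : Paper.ir R M (Ideal.span (Set.range x)) =
    Paper.ir R (Q (x (Fin.last d)) M) (Ideal.span (Set.range (Fin.init x))) :=
  (socDim_congr _ (ir_last x).some).symm

end loc
end LC
end part7

section part8
set_option linter.unusedSectionVars false
namespace LC
open IsLocalRing Module

section dim
variable {R : Type u} [CommRing R] {M N L : Type u} [AddCommGroup M] [Module R M] [AddCommGroup N] [Module R N]
  [AddCommGroup L] [Module R L]

/-- dimension at most d -/
def dimLE (R : Type u) [CommRing R] (M : Type u) [AddCommGroup M] [Module R M] (d : ℕ) : Prop :=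
  Module.supportDim R M ≤ (d : ℕ)

theorem dimLE_iff (d : ℕ) : dimLE R M d ↔ ∀ c : LTSeries (Module.support R M), c.length ≤ d := by
  unfold dimLE Module.supportDim Order.krullDim
  rw [iSup_le_iff]
  exact forall_congr' fun c => by exact_mod_cast Iff.rfl

theorem dimLE_of_inj (f : M →ₗ[R] N) (hf : Function.Injective f) {d} (h : dimLE R N d) : dimLE R M d :=
  (Module.supportDim_le_of_injective f hf).trans h
theorem dimLE_of_surj (f : M →ₗ[R] N) (hf : Function.Surjective f) {d} (h : dimLE R M d) : dimLE R N d :=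
  (Module.supportDim_le_of_surjective f hf).trans h
theorem dimLE_congr (e : M ≃ₗ[R] N) {d} (h : dimLE R M d) : dimLE R N d :=
  dimLE_of_surj (e : M →ₗ[R] N) e.surjective h
theorem dimLE_mono {d e : ℕ} (hde : d ≤ e) (h : dimLE R M d) : dimLE R M e :=
  le_trans h (by exact_mod_cast hde)
theorem dimLE_sub [Subsingleton M] (d) : dimLE R M d := by
  unfold dimLE; rw [Module.supportDim_eq_bot_of_subsingleton]; exact bot_le

theorem dimLE_ext {f : M →ₗ[R] N} {g : N →ₗ[R] L} (h : SES f g) {d} (h1 : dimLE R M d) (h2 : dimLE R L d) :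
    dimLE R N d := by
  rw [dimLE_iff] at *
  intro c
  have hs : Module.support R N = Module.support R M ∪ Module.support R L :=
    Module.support_of_exact h.exact h.inj h.surj
  have hh : c.head.1 ∈ Module.support R M ∪ Module.support R L := hs.le c.head.2
  rcases hh with hh | hh
  · have key : ∀ i, (c i).1 ∈ Module.support R M := fun i =>
      Module.mem_support_mono (c.head_le i) hh
    simpa using h1 ⟨c.length, fun i => ⟨(c i).1, key i⟩, fun i => c.step i⟩
  · have key : ∀ i, (c i).1 ∈ Module.support R L := fun i =>
      Module.mem_support_mono (c.head_le i) hh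
    simpa using h2 ⟨c.length, fun i => ⟨(c i).1, key i⟩, fun i => c.step i⟩

theorem Qequiv (y : R) : Nonempty (Q y M ≃ₗ[R] QuotSMulTop y M) :=
  ⟨Submodule.quotEquivOfEq _ _ (Submodule.ideal_span_singleton_smul y ⊤)⟩

theorem supp_Q [Module.Finite R M] (y : R) : Module.support R (Q y M) = Module.support R M ∩ PrimeSpectrum.zeroLocus {y} := by
  rw [(Qequiv y).some.support_eq, Module.support_quotSMulTop]

variable [IsLocalRing R]

theorem Dav [Module.Finite R M] [Module.Finite R L] {d : ℕ} (y : R) 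
    (hM : dimLE R M (d+1)) (hL : dimLE R L d)
    (h : ∀ p ∈ (Module.annihilator R M).minimalPrimes, y ∈ p → p = maximalIdeal R ∨ Module.annihilator R L ≤ p) :
    dimLE R (Q y M) d := by
  rw [dimLE_iff] at *
  intro c
  have hp := (supp_Q y).le c.head.2
  obtain ⟨hp1, hp2⟩ := hp
  simp only [PrimeSpectrum.mem_zeroLocus, Set.singleton_subset_iff, SetLike.mem_coe] at hp2
  obtain ⟨r, hrm, hr⟩ := Ideal.exists_minimalPrimes_le (mem_support_iff_of_finite.mp hp1)
  have hle : ∀ i, (c i).1 ∈ Module.support R M := fun i => Module.mem_support_mono (c.head_le i) hp1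
  by_cases hrp : r = c.head.1.asIdeal
  · subst hrp
    rcases h _ hrm hp2 with h | h
    · have : c.length = 0 := by
        by_contra hne
        have h1 : c.head < c.last := c.strictMono (show (0 : Fin (c.length+1)) < Fin.last _ from Fin.pos_iff_ne_zero.2 (fun hh => hne (congrArg Fin.val hh)))
        have h2 : c.head.1.asIdeal < c.last.1.asIdeal := h1
        rw [h] at h2
        exact absurd (IsLocalRing.le_maximalIdeal c.last.1.2.ne_top) h2.not_ge
      omega
    · have key : ∀ i, (c i).1 ∈ Module.support R L := fun i =>
        Module.mem_support_mono (c.head_le i) (mem_support_iff_of_finite.mpr h)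
      simpa using hL ⟨c.length, fun i => ⟨(c i).1, key i⟩, fun i => c.step i⟩
  · let c' : LTSeries (Module.support R M) := ⟨c.length, fun i => ⟨(c i).1, hle i⟩, fun i => c.step i⟩
    let r' : support R M := ⟨⟨r, hrm.isPrime⟩, mem_support_iff_of_finite.mpr hrm.1.2⟩
    have hlt : r' < c'.head := lt_of_le_of_ne hr (fun h => hrp (congrArg (fun z => z.1.asIdeal) h))
    have := hM (c'.cons r' hlt)
    simp [c'] at this
    omega

variable [IsNoetherianRing R]

theorem avoid (I : Ideal R) (S : Set (Ideal R)) (hS : S.Finite) (hp : ∀ p ∈ S, p.IsPrime)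
    (h : ∀ p ∈ S, ¬ I ≤ p) : ∃ y ∈ I, ∀ p ∈ S, y ∉ p := by
  by_contra hc
  push Not at hc
  have := (Ideal.subset_union_prime_finite (R := R) (ι := Ideal R) (s := S) hS (f := id) ⊥ ⊥ (fun p hpS _ _ => hp p hpS) (I := I)).1
    (fun y hy => by
      obtain ⟨p, hpS, hyp⟩ := hc y hy
      exact Set.mem_biUnion hpS hyp)
  obtain ⟨p, hpS, hle⟩ := this
  exact h p hpS hle

theorem minP_fin [Module.Finite R M] : (Module.annihilator R M).minimalPrimes.Finite :=
  Ideal.finite_minimalPrimes_of_isNoetherianRing R _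

theorem D4 [Module.Finite R M] [Module.Finite R L] {d : ℕ} (hM : dimLE R M (d+1)) (hL : dimLE R L d) :
    ∃ y ∈ maximalIdeal R, y ∈ Module.annihilator R L ∧ dimLE R (Q y M) d := by
  obtain ⟨y, hy, hyp⟩ := avoid (maximalIdeal R ⊓ Module.annihilator R L)
    {p | p ∈ (Module.annihilator R M).minimalPrimes ∧ ¬ (maximalIdeal R ⊓ Module.annihilator R L) ≤ p}
    (minP_fin.subset fun p hp => hp.1) (fun p hp => hp.1.isPrime) (fun p hp => hp.2)
  refine ⟨y, hy.1, hy.2, Dav y hM hL fun p hp hyp' => ?_⟩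
  by_cases hle : (maximalIdeal R ⊓ Module.annihilator R L) ≤ p
  · have := hp.isPrime
    rcases (hp.isPrime.inf_le).1 hle with h | h
    · left
      exact ((IsLocalRing.maximalIdeal.isMaximal R).eq_of_le this.ne_top h).symm
    · exact Or.inr h
  · exact absurd hyp' (hyp p ⟨hp, hle⟩)

theorem D3 [Module.Finite R M] {d : ℕ} (hM : dimLE R M (d+1)) :
    ∃ y ∈ maximalIdeal R, (∀ p ∈ associatedPrimes R M, y ∈ p → p = maximalIdeal R) ∧
      ∀ n, dimLE R (Q (y^n) M) d := by
  obtain ⟨y, hy, hyp⟩ := avoid (maximalIdeal R)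
    {p | p ∈ associatedPrimes R M ∧ ¬ maximalIdeal R ≤ p}
    ((associatedPrimes.finite R M).subset fun p hp => hp.1) (fun p hp => hp.1.isPrime) (fun p hp => hp.2)
  have key : ∀ p ∈ associatedPrimes R M, y ∈ p → p = maximalIdeal R := fun p hp hyp' => by
    by_contra hne
    exact hyp p ⟨hp, fun hle => hne ((IsLocalRing.maximalIdeal.isMaximal R).eq_of_le hp.isPrime.ne_top hle).symm⟩ hyp'
  refine ⟨y, hy, key, fun n => Dav (L := PUnit) (y^n) hM (dimLE_sub d) fun p hp hyp' => ?_⟩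
  exact Or.inl (key p (Module.associatedPrimes.minimalPrimes_annihilator_subset_associatedPrimes R M hp)
    (hp.isPrime.mem_of_pow_mem n hyp'))

theorem dim0_of_pow {n : ℕ} [Module.Finite R M] (h : maximalIdeal R ^ n ≤ Module.annihilator R M) : dimLE R M 0 := by
  rw [dimLE_iff]
  have key : ∀ p ∈ Module.support R M, p.asIdeal = maximalIdeal R := fun p hp => by
    have := p.2.pow_le_iff (n := n + 1) (by omega) |>.1 (((Ideal.pow_le_pow_right (Nat.le_succ n)).trans h).trans (mem_support_iff_of_finite.mp hp))
    exact ((IsLocalRing.maximalIdeal.isMaximal R).eq_of_le p.2.ne_top this).symm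
  intro c
  by_contra hne
  have h1 : c.head < c.last := c.strictMono (show (0 : Fin (c.length+1)) < Fin.last _ from Fin.pos_iff_ne_zero.2 (fun hh => hne (congrArg Fin.val hh).le))
  have h2 : c.head.1.asIdeal < c.last.1.asIdeal := h1
  rw [key _ c.head.2, key _ c.last.2] at h2
  exact lt_irrefl _ h2

theorem pow_of_fl (h : IsFiniteLength R M) : ∃ n, maximalIdeal R ^ n ≤ Module.annihilator R M := by
  obtain ⟨h1, h2⟩ := isFiniteLength_iff_isNoetherian_isArtinian.1 h
  obtain ⟨n, hn⟩ := IsArtinian.monotone_stabilizes (R := R) (M := M)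
    ⟨fun n => OrderDual.toDual (maximalIdeal R ^ n • ⊤ : Submodule R M), fun a b hab =>
      Submodule.smul_mono_left (Ideal.pow_le_pow_right hab)⟩
  have h3 : (maximalIdeal R ^ n • ⊤ : Submodule R M) = maximalIdeal R ^ (n+1) • ⊤ := hn (n+1) (by omega)
  have h4 : (maximalIdeal R ^ n • ⊤ : Submodule R M) = ⊥ := by
    apply Submodule.eq_bot_of_le_smul_of_le_jacobson_bot (maximalIdeal R) _ (IsNoetherian.noetherian _)
    · rw [smul_smul, ← pow_succ', ← h3]
    · exact IsLocalRing.maximalIdeal_le_jacobson ⊥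
  refine ⟨n, fun r hr => Module.mem_annihilator.2 fun m => ?_⟩
  have : r • m ∈ (maximalIdeal R ^ n • ⊤ : Submodule R M) := Submodule.smul_mem_smul hr trivial
  rwa [h4] at this

theorem fl_of_dim0 [Module.Finite R M] (h : dimLE R M 0) : IsFiniteLength R M := by
  unfold dimLE at h
  rw [supportDim_eq_ringKrullDim_quotient_annihilator] at h
  have : Ring.KrullDimLE 0 (R ⧸ Module.annihilator R M) := by
    rw [Ring.krullDimLE_iff]; exact_mod_cast h
  have : IsArtinianRing (R ⧸ Module.annihilator R M) := IsNoetherianRing.isArtinianRing_of_krullDimLE_zero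
  have hM : Module.IsTorsionBySet R M (Module.annihilator R M : Set R) := fun m r =>
    Module.mem_annihilator.1 r.2 m
  let _ := hM.module
  have : IsScalarTower R (R ⧸ Module.annihilator R M) M := hM.isScalarTower
  have : Module.Finite (R ⧸ Module.annihilator R M) M := Module.Finite.of_restrictScalars_finite R _ M
  have h2 : IsArtinian (R ⧸ Module.annihilator R M) M := inferInstance
  rw [isFiniteLength_iff_isNoetherian_isArtinian]
  refine ⟨inferInstance, ?_⟩
  exact isArtinian_of_surjective_algebraMap (R := R ⧸ Module.annihilator R M) (S := R) Ideal.Quotient.mk_surjective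

theorem pow_of_dim0 [Module.Finite R M] (h : dimLE R M 0) : ∃ n, maximalIdeal R ^ n ≤ Module.annihilator R M :=
  pow_of_fl (fl_of_dim0 h)

theorem tors_of_dim0 [Module.Finite R M] (h : dimLE R M 0) : IsTors (maximalIdeal R) M := fun x => by
  obtain ⟨n, hn⟩ := pow_of_dim0 h
  exact ⟨n, fun r hr => Module.mem_annihilator.1 (hn hr) x⟩

theorem dim0_of_tors [Module.Finite R M] (h : IsTors (maximalIdeal R) M) : dimLE R M 0 := by
  obtain ⟨s, hs⟩ := (Module.Finite.fg_top : (⊤ : Submodule R M).FG)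
  choose n hn using h
  apply dim0_of_pow (n := s.sup n)
  intro r hr
  rw [← Submodule.annihilator_top, ← hs, Submodule.mem_annihilator_span]
  rintro ⟨m, hm⟩
  exact hn m r (Ideal.pow_le_pow_right (Finset.le_sup hm) hr)

theorem sop_exists : ∀ (d : ℕ) (M : Type u) [AddCommGroup M] [Module R M] [Module.Finite R M], dimLE R M d →
    ∃ x, Paper.IsSOP R M d x
  | 0, M, _, _, _, h => ⟨Fin.elim0, fun i => i.elim0, (fl_congr (quotBot (Ideal.span (Set.range Fin.elim0)) (by simp))).2 (fl_of_dim0 h)⟩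
  | d+1, M, _, _, _, h => by
    obtain ⟨y, hy, -, h2⟩ := D3 h
    obtain ⟨s, hs⟩ := sop_exists d (Q y M) (by have h3 := h2 1; rwa [pow_one] at h3)
    exact ⟨_, (sop_cons y s).2 ⟨hy, hs⟩⟩

theorem dimLE_of_Q [Module.Finite R M] {d} {y : R} (hy : y ∈ maximalIdeal R) (h : dimLE R (Q y M) d) : dimLE R M (d+1) := by
  unfold dimLE at *
  rw [supportDim_eq_of_equiv (Qequiv y).some] at h
  refine (supportDim_le_supportDim_quotSMulTop_succ hy).trans ?_
  push_cast
  gcongr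

theorem sop_dim : ∀ (d : ℕ) (M : Type u) [AddCommGroup M] [Module R M] [Module.Finite R M] (x),
    Paper.IsSOP R M d x → dimLE R M d
  | 0, M, _, _, _, x, h => by
    obtain ⟨n, hn⟩ := pow_of_fl ((fl_congr (quotBot (Ideal.span (Set.range x)) (by simp))).1 h.2)
    exact dim0_of_pow hn
  | d+1, M, _, _, _, x, h => by
    obtain ⟨h1, h2⟩ := (sop_last x).1 h
    exact dimLE_of_Q h1 (sop_dim d _ _ h2)

theorem B1 [Module.Finite R M] {d} {a y : R} (ha : a ∈ Paper.bIdeal R M (d+1)) (hy : y ∈ maximalIdeal R)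
    (h : dimLE R (Q y M) d) (u : M) (hu : y • u = 0) : a • u = 0 := by
  obtain ⟨s, hs⟩ := sop_exists d _ h
  exact B1' ha hy s hs u hu

/-- exact dimension -/
theorem dim_Q [Module.Finite R M] {d : ℕ} {x} (h : Paper.IsSOP R M (d+1) x) (hM : supportDim R M = (d+1 : ℕ)) :
    supportDim R (Q (x (Fin.last d)) M) = d := by
  obtain ⟨h1, h2⟩ := (sop_last x).1 h
  refine le_antisymm (sop_dim d _ _ h2) ?_
  by_contra hlt
  push Not at hlt
  have h3 := supportDim_le_supportDim_quotSMulTop_succ (M := M) h1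
  rw [hM, ← supportDim_eq_of_equiv (Qequiv (x (Fin.last d))).some] at h3
  generalize supportDim R (Q (x (Fin.last d)) M) = t at *
  induction t with
  | bot => simp at h3
  | coe t =>
    induction t with
    | top => exact absurd hlt (by simp)
    | coe t => norm_cast at *; have : t < d := by exact_mod_cast hlt
               have : d + 1 ≤ t + 1 := by exact_mod_cast h3
               omega

end dim
end LC
end part8

section part9
set_option linter.unusedSectionVars false
namespace LC
open IsLocalRing Module
open scoped Pointwise

section coh
variable {R : Type u} [CommRing R] [IsLocalRing R] [IsNoetherianRing R]
 {M N L : Type u} [AddCommGroup M] [Module R M] [AddCommGroup N] [Module R N]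
  [AddCommGroup L] [Module R L]

theorem dim0_of_supp (key : ∀ p ∈ Module.support R M, p.asIdeal = maximalIdeal R) : dimLE R M 0 := by
  rw [dimLE_iff]
  intro c
  by_contra hne
  have h1 : c.head < c.last := c.strictMono (show (0 : Fin (c.length+1)) < Fin.last _ from Fin.pos_iff_ne_zero.2 (fun hh => hne (congrArg Fin.val hh).le))
  have h2 : c.head.1.asIdeal < c.last.1.asIdeal := h1
  rw [key _ c.head.2, key _ c.last.2] at h2
  exact lt_irrefl _ h2

theorem tors_of_freg [Module.Finite R M] (y : R) (h : ∀ p ∈ associatedPrimes R M, y ∈ p → p = maximalIdeal R) :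
    IsTors (maximalIdeal R) (Submodule.torsionBy R M y) := by
  apply tors_of_dim0
  apply dim0_of_supp
  intro p hp
  obtain ⟨r, hrm, hr⟩ := Ideal.exists_minimalPrimes_le (mem_support_iff_of_finite.mp hp)
  have h1 := Module.associatedPrimes.minimalPrimes_annihilator_subset_associatedPrimes R _ hrm
  have h2 := associatedPrimes.subset_of_injective (Submodule.torsionBy R M y).injective_subtype h1
  have h3 : y ∈ r := hrm.1.2 (Module.mem_annihilator.2 fun z => Subtype.ext z.2)
  have h4 := h r h2 h3
  subst h4
  exact ((IsLocalRing.maximalIdeal.isMaximal R).eq_of_le p.2.ne_top hr).symm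

/-- multiplication by `y` factored through `M ⧸ U`. -/
def tl (U : Submodule R M) (y : R) (h : ∀ u ∈ U, y • u = 0) : (M ⧸ U) →ₗ[R] M :=
  U.liftQ (LinearMap.lsmul R M y) (fun u hu => by simpa using h u hu)

theorem tl_comp (U : Submodule R M) (y : R) (h) : tl U y h ∘ₗ U.mkQ = y • LinearMap.id := by
  ext; simp [tl]

theorem tl_mk (U : Submodule R M) (y : R) (h) (m : M) : tl U y h (Submodule.Quotient.mk m) = y • m := by
  simp [tl]

theorem mem_span_smul_top (x : R) (m : M) : m ∈ (Ideal.span {x} • ⊤ : Submodule R M) ↔ ∃ n, x • n = m := by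
  rw [Submodule.ideal_span_singleton_smul, Submodule.mem_smul_pointwise_iff_exists]; simp

theorem tl_ses (x : R) : SES (tl (Submodule.torsionBy R M x) x (fun u hu => (Submodule.mem_torsionBy_iff x u).1 hu)) 
    (Ideal.span {x} • ⊤ : Submodule R M).mkQ where
  inj := by
    rw [injective_iff_map_eq_zero]
    intro a ha
    obtain ⟨m, rfl⟩ := Submodule.Quotient.mk_surjective _ a
    rw [tl_mk] at ha
    exact (Submodule.Quotient.mk_eq_zero _).2 ha
  exact := by
    intro m
    simp only [Submodule.mkQ_apply, Submodule.Quotient.mk_eq_zero, mem_span_smul_top, Set.mem_range]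
    constructor
    · rintro ⟨n, rfl⟩; exact ⟨Submodule.Quotient.mk n, tl_mk _ _ _ _⟩
    · rintro ⟨n, rfl⟩
      obtain ⟨n, rfl⟩ := Submodule.Quotient.mk_surjective _ n
      exact ⟨n, (tl_mk _ _ _ _).symm⟩
  surj := Submodule.mkQ_surjective _

abbrev mm (R : Type u) [CommRing R] [IsLocalRing R] := maximalIdeal R

theorem hmap_tl (U : Submodule R M) (y : R) (h) (i) (ξ : HH (mm R) i M) :
    hmap (mm R) i (tl U y h) (hmap (mm R) i U.mkQ ξ) = y • ξ := by
  rw [← hmap_comp_apply, tl_comp, hmap_smul, hmap_id]; rfl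

theorem zstep [Module.Finite R M] {d : ℕ} (hM : dimLE R M (d+1)) (j : ℕ) (ξ : HH (mm R) (j+1) M) :
    ∃ z ∈ maximalIdeal R, dimLE R (Q z M) d ∧ ∃ η : HH (mm R) j (Q z M), ∀ a : R, a • η = 0 → a • ξ = 0 := by
  obtain ⟨y, hy, hf, hd⟩ := D3 hM
  obtain ⟨n, hn⟩ := HH_tors (mm R) (j+1) ξ
  have hz : y^(n+1) • ξ = 0 := by
    rw [pow_succ', mul_smul, hn _ (Ideal.pow_mem_pow hy n), smul_zero]
  refine ⟨y^(n+1), Ideal.pow_mem_of_mem _ hy _ (by omega), hd _, ?_⟩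
  generalize hz' : y^(n+1) = z at *
  have hK : IsTors (maximalIdeal R) (Submodule.torsionBy R M z) := tors_of_freg z (fun p hp hzp => 
    hf p hp (hp.isPrime.mem_of_pow_mem (n+1) (hz' ▸ hzp)))
  have h0 := hmap_tl (Submodule.torsionBy R M z) z (fun u hu => (Submodule.mem_torsionBy_iff z u).1 hu) (j+1) ξ
  rw [hz] at h0
  obtain ⟨η, hη⟩ := hex1 (mm R) (tl_ses z) j _ h0
  refine ⟨η, fun a ha => ?_⟩
  have h1 : hmap (mm R) (j+1) (Submodule.torsionBy R M z).mkQ (a • ξ) = 0 := by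
    rw [map_smul, ← hη, ← map_smul, ha, map_zero]
  obtain ⟨w, hw⟩ := hex2 (mm R) (SES.sub _) (j+1) _ h1
  rw [← hw, HH_of_tors _ _ _ hK w, map_zero]

/-- vanishing of local cohomology in degree i -/
def HZ (M : Type u) [AddCommGroup M] [Module R M] (i : ℕ) : Prop := ∀ ξ : HH (mm R) i M, ξ = 0

theorem vanish : ∀ (d : ℕ) (M : Type u) [AddCommGroup M] [Module R M] [Module.Finite R M], dimLE R M d →
    ∀ i, d < i → HZ (R := R) M i
  | 0, M, _, _, _, h, i, hi => by
    obtain ⟨i, rfl⟩ := Nat.exists_eq_succ_of_ne_zero hi.ne'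
    exact fun ξ => HH_of_tors _ _ _ (tors_of_dim0 h) ξ
  | d+1, M, _, _, _, h, i, hi => by
    obtain ⟨i, rfl⟩ := Nat.exists_eq_succ_of_ne_zero (by omega : i ≠ 0)
    intro ξ
    obtain ⟨z, hz, hd, η, hη⟩ := zstep h i ξ
    simpa using hη 1 (by rw [vanish d _ hd i (by omega) η, smul_zero])

theorem lemB : ∀ (i d : ℕ) (M : Type u) [AddCommGroup M] [Module R M] [Module.Finite R M], dimLE R M d →
    ∀ a ∈ Paper.bIdeal R M d, i < d → ∀ ξ : HH (mm R) i M, a • ξ = 0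
  | i, 0, M, _, _, _, h, a, ha, hi, ξ => absurd hi (by omega)
  | 0, d+1, M, _, _, _, h, a, ha, hi, ξ => by
    obtain ⟨y, hy, hf, hd⟩ := D3 h
    obtain ⟨n, hn⟩ := HH_tors (mm R) 0 ξ
    have hz : y^(n+1) • ξ = 0 := by
      rw [pow_succ', mul_smul, hn _ (Ideal.pow_mem_pow hy n), smul_zero]
    apply ev_inj (mm R)
    rw [map_zero, map_smul]
    apply B1 ha (Ideal.pow_mem_of_mem _ hy (n+1) (by omega)) (hd _)
    rw [← map_smul, hz, map_zero]
  | i+1, d+1, M, _, _, _, h, a, ha, hi, ξ => by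
    obtain ⟨z, hz, hd, η, hη⟩ := zstep h i ξ
    exact hη a (lemB i d _ hd a (B2 ha hz) (by omega) η)

theorem HZ_congr (e : M ≃ₗ[R] N) {i} (h : HZ (R := R) M i) : HZ (R := R) N i := fun ξ => by
  have := h ((hEquiv (mm R) i e).symm ξ)
  simpa using this

theorem HZ_mid {f : M →ₗ[R] N} {g : N →ₗ[R] L} (h : SES f g) {i} (h1 : HZ (R := R) M i) (h2 : HZ (R := R) L i) :
    HZ (R := R) N i := fun ξ => by
  obtain ⟨w, hw⟩ := hex2 (mm R) h i ξ (h2 _)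
  rw [← hw, h1 w, map_zero]

theorem HZ_right {f : M →ₗ[R] N} {g : N →ₗ[R] L} (h : SES f g) {i} (h1 : HZ (R := R) N i) (h2 : HZ (R := R) M (i+1)) :
    HZ (R := R) L i := fun ξ => by
  obtain ⟨w, hw⟩ := hex3 (mm R) h i ξ (h2 _)
  rw [← hw, h1 w, map_zero]

theorem HZ_left {f : M →ₗ[R] N} {g : N →ₗ[R] L} (h : SES f g) {i} (h1 : HZ (R := R) N (i+1)) (h2 : HZ (R := R) L i) :
    HZ (R := R) M (i+1) := fun ξ => by
  obtain ⟨w, hw⟩ := hex1 (mm R) h i ξ (h1 _)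
  rw [← hw, h2 w, map_zero]

theorem HZ_left0 {f : M →ₗ[R] N} (hf : Function.Injective f) (h1 : HZ (R := R) N 0) :
    HZ (R := R) M 0 := fun ξ => by
  apply hmap_inj_zero (mm R) hf
  rw [h1 (hmap _ _ f ξ), map_zero]

theorem reg_of_H0 [Module.Finite R M] (h : HZ (R := R) M 0) : ∃ y ∈ maximalIdeal R, IsSMulRegular M y := by
  obtain ⟨y, hy, hyp⟩ := avoid (maximalIdeal R) (associatedPrimes R M) (associatedPrimes.finite R M)
    (fun p hp => hp.isPrime) (fun p hp hle => by
      have h1 := (IsLocalRing.maximalIdeal.isMaximal R).eq_of_le hp.isPrime.ne_top hle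
      subst h1
      obtain ⟨-, u, hu⟩ := (isAssociatedPrime_iff).1 hp
      obtain ⟨ξ, hξ⟩ := ev_surj (mm R) 1 u (fun r hr => by
        rw [pow_one] at hr
        have : r ∈ (⊥ : Submodule R M).colon {u} := hu ▸ hr
        simpa using this)
      rw [h ξ, map_zero] at hξ
      subst hξ
      have : (1 : R) ∈ maximalIdeal R := by rw [hu]; simp
      exact (IsLocalRing.maximalIdeal.isMaximal R).ne_top ((Ideal.eq_top_iff_one _).2 this))
  refine ⟨y, hy, ?_⟩
  by_contra hc
  rw [isSMulRegular_iff_right_eq_zero_of_smul] at hc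
  push Not at hc
  obtain ⟨m, hm, hm0⟩ := hc
  have : y ∈ ⋃ p ∈ associatedPrimes R M, (p : Set R) := by
    rw [biUnion_associatedPrimes_eq_zero_divisors]; exact ⟨m, hm0, hm⟩
  simp only [Set.mem_iUnion] at this
  obtain ⟨p, hp, hyp'⟩ := this
  exact hyp p hp hyp'

theorem reg_ses (y : R) (h : IsSMulRegular M y) : SES (LinearMap.lsmul R M y) (y • ⊤ : Submodule R M).mkQ where
  inj := h
  exact := by
    intro m
    simp only [Submodule.mkQ_apply, Submodule.Quotient.mk_eq_zero, Submodule.mem_smul_pointwise_iff_exists]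
    simp
  surj := Submodule.mkQ_surjective _

theorem regseq : ∀ (n : ℕ) (M : Type u) [AddCommGroup M] [Module R M] [Module.Finite R M] [Nontrivial M], 
    (∀ i < n, HZ (R := R) M i) → ∃ rs : List R, rs.length = n ∧ (∀ r ∈ rs, r ∈ maximalIdeal R) ∧ RingTheory.Sequence.IsRegular M rs
  | 0, M, _, _, _, _, h => ⟨[], rfl, by simp, RingTheory.Sequence.IsRegular.nil R M⟩
  | n+1, M, _, _, _, _, h => by
    obtain ⟨y, hy, hr⟩ := reg_of_H0 (h 0 (by omega))
    have : Nontrivial (QuotSMulTop y M) := by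
      rw [← not_subsingleton_iff_nontrivial]
      intro hs
      have h1 := Submodule.Quotient.subsingleton_iff.1 hs
      have h2 : (⊤ : Submodule R M) = ⊥ := by
        apply Submodule.eq_bot_of_le_smul_of_le_jacobson_bot (Ideal.span {y}) _ Module.Finite.fg_top
        · rw [Submodule.ideal_span_singleton_smul, h1]
        · exact (Ideal.span_le.2 (by simpa using hy)).trans (IsLocalRing.maximalIdeal_le_jacobson ⊥)
      have h3 : Subsingleton M := Submodule.subsingleton_iff R |>.1 (subsingleton_of_bot_eq_top h2.symm)
      exact not_subsingleton M h3
    obtain ⟨rs, h1, h2, h3⟩ := regseq n (QuotSMulTop y M) (fun i hi => 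
      HZ_right (reg_ses y hr) (h i (by omega)) (h (i+1) (by omega)))
    refine ⟨y :: rs, by simp [h1], by simpa using ⟨hy, h2⟩, ?_⟩
    exact (RingTheory.Sequence.isRegular_cons_iff M y rs).2 ⟨hr, h3⟩

theorem hmap_lsmul (y : R) (i) (ξ : HH (mm R) i M) : hmap (mm R) i (LinearMap.lsmul R M y) ξ = y • ξ := by
  have : LinearMap.lsmul R M y = y • LinearMap.id := by ext; simp
  rw [this, hmap_smul, hmap_id]; rfl

theorem eq_zero_of_inj (i) (y : R) (hy : y ∈ maximalIdeal R) (h : ∀ ξ : HH (mm R) i M, y • ξ = 0 → ξ = 0) : HZ (R := R) M i := by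
  intro ξ
  obtain ⟨n, hn⟩ := HH_tors (mm R) i ξ
  have hz : y^n • ξ = 0 := hn _ (Ideal.pow_mem_pow hy n)
  clear hn
  induction n with
  | zero => simpa using hz
  | succ n ih => exact ih (h _ (by rw [← mul_smul, ← pow_succ', hz]))

theorem HZ_of_regseq : ∀ (rs : List R) (M : Type u) [AddCommGroup M] [Module R M] [Module.Finite R M], 
   (∀ r ∈ rs, r ∈ maximalIdeal R) → RingTheory.Sequence.IsRegular M rs → ∀ i < rs.length, HZ (R := R) M i
  | [], M, _, _, _, _, h, i, hi => absurd hi (by simp)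
  | y :: rs, M, _, _, _, hm, h, i, hi => by
    obtain ⟨hr, h3⟩ := (RingTheory.Sequence.isRegular_cons_iff M y rs).1 h
    have ih := HZ_of_regseq rs (QuotSMulTop y M) (fun r hr => hm r (by simp [hr])) h3
    apply eq_zero_of_inj i y (hm y (by simp))
    intro ξ hξ
    rw [← hmap_lsmul] at hξ
    cases i with
    | zero => exact hmap_inj_zero (mm R) (f := LinearMap.lsmul R M y) hr (hξ.trans (map_zero _).symm)
    | succ i => 
      obtain ⟨w, hw⟩ := hex1 (mm R) (reg_ses y hr) i ξ hξ
      rw [← hw, ih i (by simpa using hi) w, map_zero]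

theorem mdim_eq [Module.Finite R M] : Paper.mdim R M = supportDim R M :=
  (supportDim_eq_ringKrullDim_quotient_annihilator R M).symm

theorem CM_iff [Module.Finite R M] {d : ℕ} (hd : supportDim R M = d) :
    Paper.IsCM R M ↔ ∀ i < d, HZ (R := R) M i := by
  have hnt : Nontrivial M := by
    rw [← supportDim_ne_bot_iff_nontrivial R, hd]; exact WithBot.natCast_ne_bot d
  have hle : ∀ rs : List R, RingTheory.Sequence.IsRegular M rs → rs.length ≤ d := fun rs hrs => by
    have h1 := supportDim_add_length_eq_supportDim_of_isRegular rs hrs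
    rw [hd] at h1
    generalize supportDim R (M ⧸ Ideal.ofList rs • (⊤ : Submodule R M)) = t at h1
    induction t with
    | bot => simp at h1
    | coe t =>
      have h2 : t + rs.length = d := by exact_mod_cast h1
      have : (rs.length : ℕ∞) ≤ d := by rw [← h2]; exact le_add_self
      exact_mod_cast this
  have hle2 : Paper.depth R M ≤ (d : WithTop ℕ) := by
    apply sSup_le
    rintro n ⟨rs, rfl, -, hrs⟩
    exact_mod_cast hle rs hrs
  unfold Paper.IsCM
  rw [mdim_eq, hd]
  constructor
  · intro h i hi
    have h1 : Paper.depth R M = (d : WithTop ℕ) := WithBot.coe_injective h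
    have h2 : (i : WithTop ℕ) < Paper.depth R M := by rw [h1]; exact_mod_cast hi
    obtain ⟨n, ⟨rs, rfl, hm, hrs⟩, hn⟩ := lt_sSup_iff.1 h2
    exact HZ_of_regseq rs M hm hrs i (by exact_mod_cast hn)
  · intro h
    obtain ⟨rs, h1, h2, h3⟩ := regseq d M h
    have h4 : Paper.depth R M = (d : WithTop ℕ) := le_antisymm hle2 (le_sSup ⟨rs, by rw [h1], h2, h3⟩)
    rw [h4]; rfl
end coh
end LC
end part9

section part10
set_option linter.unusedSectionVars false
namespace LC
open IsLocalRing Module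

section soc
variable {R : Type u} [CommRing R] 
 {A B C : Type u} [AddCommGroup A] [Module R A] [AddCommGroup B] [Module R B]
  [AddCommGroup C] [Module R C]

/-- map on socles -/
def socMap (I : Ideal R) (f : A →ₗ[R] B) :
    Submodule.torsionBySet R A (I : Set R) →ₗ[R ⧸ I] Submodule.torsionBySet R B (I : Set R) where
  toFun z := ⟨f z.1, by
    have := z.2
    rw [Submodule.mem_torsionBySet_iff] at this ⊢
    intro r; rw [← map_smul, this r, map_zero]⟩
  map_add' a b := by ext; simp
  map_smul' r z := by
    obtain ⟨r, rfl⟩ := Ideal.Quotient.mk_surjective r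
    ext
    exact f.map_smul r z.1

def fsoc (I : Ideal R) (A : Type u) [AddCommGroup A] [Module R A] : Prop :=
  Module.Finite (R ⧸ I) (Submodule.torsionBySet R A (I : Set R))

theorem mem_soc (I : Ideal R) (z : A) : z ∈ Submodule.torsionBySet R A (I : Set R) ↔ ∀ r ∈ I, r • z = 0 := by
  rw [Submodule.mem_torsionBySet_iff]; simp

theorem soc_exact [IsLocalRing R] (f : A →ₗ[R] B) (g : B →ₗ[R] C) (hf : Function.Injective f)
    (hfg : ∀ a, g (f a) = 0)
    (he : ∀ b, g b = 0 → ∃ a, f a = b)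
    (hs : ∀ c, (∀ r ∈ maximalIdeal R, r • c = 0) → ∃ b, (∀ r ∈ maximalIdeal R, r • b = 0) ∧ g b = c)
    (hB : fsoc (maximalIdeal R) B) :
    fsoc (maximalIdeal R) A ∧ fsoc (maximalIdeal R) C ∧
      Paper.socDim R (maximalIdeal R) B = Paper.socDim R (maximalIdeal R) A + Paper.socDim R (maximalIdeal R) C := by
  let _ : Field (R ⧸ maximalIdeal R) := Ideal.Quotient.field (maximalIdeal R)
  unfold fsoc at *
  have h1 : Function.Injective (socMap (maximalIdeal R) f) := fun a b h =>
    Subtype.ext (hf (congrArg Subtype.val h))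
  have h2 : Function.Surjective (socMap (maximalIdeal R) g) := fun c => by
    obtain ⟨b, hb, h⟩ := hs c.1 ((mem_soc _ _).1 c.2)
    exact ⟨⟨b, (mem_soc _ _).2 hb⟩, Subtype.ext h⟩
  have h3 : LinearMap.range (socMap (maximalIdeal R) f) = LinearMap.ker (socMap (maximalIdeal R) g) := by
    ext b
    rw [LinearMap.mem_range, LinearMap.mem_ker]
    constructor
    · rintro ⟨a, rfl⟩; exact Subtype.ext (hfg a.1)
    · intro h
      obtain ⟨a, ha⟩ := he b.1 (congrArg Subtype.val h)
      refine ⟨⟨a, (mem_soc _ _).2 fun r hr => hf ?_⟩, Subtype.ext ha⟩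
      rw [map_smul, ha, map_zero, (mem_soc _ _).1 b.2 r hr]
  refine ⟨Module.Finite.of_injective _ h1, Module.Finite.of_surjective _ h2, ?_⟩
  unfold Paper.socDim
  rw [← LinearMap.finrank_range_add_finrank_ker (socMap (maximalIdeal R) g), ← h3,
    LinearMap.finrank_range_of_inj h1, LinearMap.range_eq_top.2 h2, finrank_top, add_comm]

theorem fsoc_congr [IsLocalRing R] (e : A ≃ₗ[R] B) (h : fsoc (maximalIdeal R) A) : fsoc (maximalIdeal R) B := by
  unfold fsoc at *
  exact Module.Finite.equiv (torsionEquiv _ e)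

theorem zero_of_soc [IsLocalRing R] (h : IsTors (maximalIdeal R) A) (hf : fsoc (maximalIdeal R) A)
    (h0 : Paper.socDim R (maximalIdeal R) A = 0) (z : A) : z = 0 := by
  let _ : Field (R ⧸ maximalIdeal R) := Ideal.Quotient.field (maximalIdeal R)
  unfold fsoc at hf
  have hs : Subsingleton (Submodule.torsionBySet R A (maximalIdeal R : Set R)) := Module.finrank_zero_iff.1 h0
  have key : ∀ z : A, (∀ r ∈ maximalIdeal R, r • z = 0) → z = 0 := fun z hz =>
    congrArg Subtype.val (hs.elim ⟨z, (mem_soc _ _).2 hz⟩ 0)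
  obtain ⟨n, hn⟩ := h z
  induction n generalizing z with
  | zero => simpa using hn 1 (by simp)
  | succ n ih =>
    apply key
    intro r hr
    apply ih
    intro s hs
    rw [← mul_smul]
    exact hn _ (by rw [pow_succ]; exact Ideal.mul_mem_mul hs hr)

end soc

section main
variable {R : Type u} [CommRing R] [IsLocalRing R] [IsNoetherianRing R]
 {M N L : Type u} [AddCommGroup M] [Module R M] [AddCommGroup N] [Module R N]
  [AddCommGroup L] [Module R L]

theorem decomp (I J : Ideal R) {x : R} (hx : x ∈ I * J) : ∃ (ι : Type) (_ : Fintype ι) (a y : ι → R),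
    (∀ j, a j ∈ I) ∧ (∀ j, y j ∈ J) ∧ x = ∑ j, a j * y j := by
  induction hx using Submodule.mul_induction_on' with
  | mem_mul_mem m hm n hn => exact ⟨PUnit, inferInstance, fun _ => m, fun _ => n, fun _ => hm, fun _ => hn, by simp⟩
  | add x hx y hy h1 h2 =>
    obtain ⟨ι, _, a, b, ha, hb, rfl⟩ := h1
    obtain ⟨κ, _, a', b', ha', hb', rfl⟩ := h2
    refine ⟨ι ⊕ κ, inferInstance, Sum.elim a a', Sum.elim b b', ?_, ?_, ?_⟩
    · rintro (j | j); exacts [ha j, ha' j]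
    · rintro (j | j); exacts [hb j, hb' j]
    · simp

theorem decomp3 (b : Ideal R) {x : R} (hx : x ∈ b^3) (hm : x ∈ maximalIdeal R) : ∃ (ι : Type) (_ : Fintype ι) (a y : ι → R),
    (∀ j, a j ∈ b) ∧ (∀ j, y j ∈ b * b) ∧ (∀ j, y j ∈ maximalIdeal R) ∧ x = ∑ j, a j * y j := by
  by_cases hb : b = ⊤
  · exact ⟨PUnit, inferInstance, fun _ => 1, fun _ => x, by simp [hb], by simp [hb, Ideal.mul_top], fun _ => hm, by simp⟩
  · rw [pow_succ', pow_two] at hx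
    obtain ⟨ι, i, a, y, h1, h2, h3⟩ := decomp _ _ hx
    exact ⟨ι, i, a, y, h1, h2, fun j => le_maximalIdeal hb (Ideal.mul_le_left (h2 j)), h3⟩

theorem hmap_sum {ι : Type} [Fintype ι] (i) (f : ι → (M →ₗ[R] N)) (ξ) :
    hmap (mm R) i (∑ j, f j) ξ = ∑ j, hmap (mm R) i (f j) ξ := by
  classical
  have : ∀ s : Finset ι, hmap (mm R) i (∑ j ∈ s, f j) ξ = ∑ j ∈ s, hmap (mm R) i (f j) ξ := by
    intro s
    induction s using Finset.induction_on with
    | empty => simp only [Finset.sum_empty]; rw [hmap_zero]; rfl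
    | insert a s ha ih => rw [Finset.sum_insert ha, Finset.sum_insert ha, hmap_add, ← ih]; rfl
  exact this _

theorem hmap_tl_zero [Module.Finite R M] {d : ℕ} (hM : dimLE R M d) (K : Submodule R M)
    (hK : ∀ a ∈ Paper.bIdeal R M d, ∀ u ∈ K, a • u = 0) (y : R)
    (hy : y ∈ Paper.bIdeal R M d * Paper.bIdeal R M d) (h) (i) (hi : i < d) (ξ) : hmap (mm R) i (tl K y h) ξ = 0 := by
  obtain ⟨ι, _, a, z, ha, hz, rfl⟩ := decomp _ _ hy
  have : tl K _ h = ∑ j, a j • tl K (z j) (hK _ (hz j)) := by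
    apply Submodule.linearMap_qext
    ext m
    simp only [LinearMap.comp_apply, Submodule.mkQ_apply, LinearMap.sum_apply, LinearMap.smul_apply, tl_mk,
      Finset.sum_smul, mul_smul]
  rw [this, hmap_sum]
  refine Finset.sum_eq_zero fun j _ => ?_
  rw [hmap_smul]
  exact lemB i d M hM (a j) (ha j) hi _

theorem HH_pi_zero {ι : Type} [Fintype ι] (i) (w : HH (mm R) i (ι → M))
    (h : ∀ j, hmap (mm R) i (LinearMap.proj (R := R) (φ := fun _ : ι => M) j) w = 0) : w = 0 := by
  classical
  have : (LinearMap.id : (ι → M) →ₗ[R] (ι → M)) = ∑ j, LinearMap.single R (fun _ : ι => M) j ∘ₗ LinearMap.proj j := by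
    ext1 v
    ext j
    simp [Pi.single_apply]
  have h2 : hmap (mm R) i (LinearMap.id : (ι → M) →ₗ[R] (ι → M)) w = w := by rw [hmap_id]; rfl
  rw [← h2, this, hmap_sum]
  refine Finset.sum_eq_zero fun j _ => ?_
  rw [hmap_comp_apply, h j, map_zero]

theorem dimLE_of_supp {d : ℕ} (h : dimLE R N d) (hs : Module.support R M ⊆ Module.support R N) : dimLE R M d := by
  rw [dimLE_iff] at *
  intro c
  simpa using h ⟨c.length, fun i => ⟨(c i).1, hs (c i).2⟩, fun i => c.step i⟩

theorem dimLE_K [Module.Finite R M] {d : ℕ} {x : R} (hQ : dimLE R (Q x M) d) : dimLE R (Submodule.torsionBy R M x) d := by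
  apply dimLE_of_supp hQ
  intro p hp
  rw [supp_Q]
  refine ⟨Module.support_subset_of_injective _ (Submodule.torsionBy R M x).injective_subtype hp, ?_⟩
  have := (mem_support_iff_of_finite.mp hp)
  simp only [PrimeSpectrum.mem_zeroLocus, Set.singleton_subset_iff, SetLike.mem_coe]
  exact this (Module.mem_annihilator.2 fun z => Subtype.ext z.2)

variable [Module.Finite R M] {d : ℕ} {x : R}


theorem killK (hx : x ∈ maximalIdeal R) (hQ : dimLE R (Q x M) d) : ∀ a ∈ (Paper.bIdeal R M (d+1)), ∀ u ∈ (Submodule.torsionBy R M x), a • u = 0 :=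
  fun _ ha u hu => B1 ha hx hQ u ((Submodule.mem_torsionBy_iff x u).1 hu)

theorem x_mem_bb (hb : x ∈ (Paper.bIdeal R M (d+1)) ^ 3) : x ∈ (Paper.bIdeal R M (d+1)) * (Paper.bIdeal R M (d+1)) := by
  rw [← pow_two]; exact Ideal.pow_le_pow_right (by norm_num) hb

theorem top_bij (hQ : dimLE R (Q x M) d) : Function.Bijective (hmap (mm R) (d+1) (Submodule.mkQ (Submodule.torsionBy R M x))) := by
  have hK := dimLE_K hQ
  constructor
  · rw [injective_iff_map_eq_zero]
    intro ξ hξ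
    obtain ⟨w, hw⟩ := hex2 (mm R) (SES.sub _) _ _ hξ
    rw [← hw, vanish d _ hK (d+1) (by omega) w, map_zero]
  · intro ξ
    exact hex3 (mm R) (SES.sub _) _ ξ (vanish d _ hK (d+2) (by omega) _)

theorem pi_inj (hM : dimLE R M (d+1)) (hx : x ∈ maximalIdeal R) (hb : x ∈ (Paper.bIdeal R M (d+1)) ^ 3) (hQ : dimLE R (Q x M) d) (i) (hi : i < d + 1) :
    Function.Injective (hmap (mm R) i (Ideal.span {x} • ⊤ : Submodule R M).mkQ) := by
  rw [injective_iff_map_eq_zero]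
  intro ξ hξ
  obtain ⟨w, hw⟩ := hex2 (mm R) (tl_ses x) _ _ hξ
  rw [← hw]
  exact hmap_tl_zero hM _ (killK hx hQ) x (x_mem_bb hb) _ i hi w

theorem H0bar (hM : dimLE R M (d+1)) (hx : x ∈ maximalIdeal R) (hb : x ∈ (Paper.bIdeal R M (d+1)) ^ 3) (hQ : dimLE R (Q x M) d) :
    HZ (R := R) (M ⧸ (Submodule.torsionBy R M x)) 0 := by
  intro ξ
  apply hmap_inj_zero (mm R) (tl_ses (M := M) x).inj
  rw [hmap_tl_zero hM _ (killK hx hQ) x (x_mem_bb hb) _ 0 (by omega) ξ, map_zero]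

theorem soc_lift (hM : dimLE R M (d+1)) (hx : x ∈ maximalIdeal R) (hb : x ∈ (Paper.bIdeal R M (d+1)) ^ 3) (hQ : dimLE R (Q x M) d) (i) (hi : i < d + 1)
    (ξ : HH (mm R) (i+1) (M ⧸ (Submodule.torsionBy R M x))) (hξ : ∀ r ∈ maximalIdeal R, r • ξ = 0) :
    ∃ η : HH (mm R) i (Q x M), (∀ r ∈ maximalIdeal R, r • η = 0) ∧ delta (mm R) (tl_ses x) i η = ξ := by
  obtain ⟨ι, _, a, y, ha, hy, hym, hxs⟩ := decomp3 _ hb hx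
  have hkill := killK hx hQ
  have hyk : ∀ j, ∀ u ∈ (Submodule.torsionBy R M x), y j • u = 0 := fun j => hkill _ (Ideal.mul_le_left (hy j))
  let Y : (M ⧸ (Submodule.torsionBy R M x)) →ₗ[R] (ι → M) := LinearMap.pi fun j => tl (Submodule.torsionBy R M x) (y j) (hyk j)
  let S : (ι → M) →ₗ[R] M := ∑ j, a j • LinearMap.proj j
  have hSY : S ∘ₗ Y = tl (Submodule.torsionBy R M x) x (fun u hu => (Submodule.mem_torsionBy_iff x u).1 hu) := by
    apply Submodule.linearMap_qext
    ext m
    simp only [LinearMap.comp_apply, Submodule.mkQ_apply, S, Y, LinearMap.sum_apply, LinearMap.smul_apply, tl_mk,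
      LinearMap.proj_apply, LinearMap.pi_apply]
    conv_rhs => rw [hxs, Finset.sum_smul]
    simp only [mul_smul]
  have hYi : Function.Injective Y := by
    have : Function.Injective (S ∘ₗ Y) := by rw [hSY]; exact (tl_ses (M := M) x).inj
    exact Function.Injective.of_comp (f := S) this
  let c : ((ι → M) ⧸ LinearMap.range Y) →ₗ[R] Q x M := Submodule.mapQ _ _ S (by
    rintro _ ⟨w, rfl⟩
    have h1 : S (Y w) = tl (Submodule.torsionBy R M x) x (fun u hu => (Submodule.mem_torsionBy_iff x u).1 hu) w := LinearMap.congr_fun hSY w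
    rw [Submodule.mem_comap, h1]
    obtain ⟨w, rfl⟩ := Submodule.Quotient.mk_surjective _ w
    rw [tl_mk, mem_span_smul_top]
    exact ⟨w, rfl⟩)
  have hS : ∀ w : HH (mm R) i (ι → M), hmap (mm R) i S w = 0 := fun w => by
    rw [hmap_sum]
    refine Finset.sum_eq_zero fun j _ => ?_
    rw [hmap_smul]
    exact lemB i _ M hM (a j) (ha j) hi _
  have hYξ : hmap (mm R) (i+1) Y ξ = 0 := by
    apply HH_pi_zero
    intro j
    rw [← hmap_comp_apply]
    have : LinearMap.proj j ∘ₗ Y = tl (Submodule.torsionBy R M x) (y j) (hyk j) := by ext; simp [Y]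
    rw [this]
    by_cases hi' : i + 1 < d + 1
    · exact hmap_tl_zero hM _ hkill (y j) (hy j) _ _ hi' ξ
    · obtain rfl : i = d := by omega
      obtain ⟨ζ, rfl⟩ := (top_bij hQ).2 ξ
      rw [hmap_tl]
      apply (top_bij hQ).1
      rw [map_smul, hξ _ (hym j), map_zero]
  obtain ⟨η, hη⟩ := hex1 (mm R) (SES.mkQ hYi) i ξ hYξ
  have hcomm : c ∘ₗ (LinearMap.range Y).mkQ = (Ideal.span {x} • ⊤ : Submodule R M).mkQ ∘ₗ S := by
    ext; rfl
  refine ⟨hmap (mm R) i c η, fun r hr => ?_, ?_⟩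
  · have h1 : delta (mm R) (SES.mkQ hYi) i (r • η) = 0 := by rw [map_smul, hη, hξ r hr]
    obtain ⟨w, hw⟩ := hex3 (mm R) _ i _ h1
    rw [← map_smul, ← hw, ← hmap_comp_apply, hcomm, hmap_comp_apply, hS, map_zero]
  · have := delta_nat (mm R) (SES.mkQ hYi) i (tl_ses (M := M) x) LinearMap.id S c (by rw [hSY]; rfl) hcomm η
    rw [← this, hη, hmap_id]; rfl

/-- the main numerical step -/
theorem main_step (hM : dimLE R M (d+1)) (hx : x ∈ maximalIdeal R) (hb : x ∈ (Paper.bIdeal R M (d+1)) ^ 3) (hQ : dimLE R (Q x M) d)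
    (hf : ∀ i ≤ d, fsoc (maximalIdeal R) (HH (mm R) i (Q x M))) :
    (∀ i ≤ d + 1, fsoc (maximalIdeal R) (HH (mm R) i M)) ∧
    (∀ i ≤ d, fsoc (maximalIdeal R) (HH (mm R) (i+1) (M ⧸ (Submodule.torsionBy R M x)))) ∧
    ∑ i ∈ Finset.range (d+1), Paper.socH R (Q x M) i =
      ∑ i ∈ Finset.range (d+2), Paper.socH R M i + ∑ i ∈ Finset.range d, Paper.socH R (M ⧸ (Submodule.torsionBy R M x)) (i+1) := by
  have key : ∀ i ≤ d, fsoc (maximalIdeal R) (HH (mm R) i M) ∧ fsoc (maximalIdeal R) (HH (mm R) (i+1) (M ⧸ (Submodule.torsionBy R M x))) ∧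
      Paper.socH R (Q x M) i = Paper.socH R M i + Paper.socH R (M ⧸ (Submodule.torsionBy R M x)) (i+1) := fun i hi =>
    soc_exact (hmap (mm R) i (Ideal.span {x} • ⊤ : Submodule R M).mkQ) (delta (mm R) (tl_ses x) i)
      (pi_inj hM hx hb hQ i (by omega)) (delta_hmap (mm R) (tl_ses x) i) (hex3 (mm R) (tl_ses x) i)
      (soc_lift hM hx hb hQ i (by omega)) (hf i hi)
  let e := LinearEquiv.ofBijective _ (top_bij hQ)
  have htop : Paper.socH R M (d+1) = Paper.socH R (M ⧸ (Submodule.torsionBy R M x)) (d+1) := socDim_congr _ e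
  refine ⟨fun i hi => ?_, fun i hi => (key i hi).2.1, ?_⟩
  · by_cases h : i ≤ d
    · exact (key i h).1
    · obtain rfl : i = d + 1 := by omega
      exact fsoc_congr e.symm (key d le_rfl).2.1
  · rw [Finset.sum_congr rfl fun i hi => (key i (by simpa [Nat.lt_succ_iff] using hi)).2.2, Finset.sum_add_distrib,
      Finset.sum_range_succ (fun i => Paper.socH R (M ⧸ (Submodule.torsionBy R M x)) (i+1)) d, ← htop, Finset.sum_range_succ _ (d+1)]
    ring

end main
end LC
end part10

section part11
set_option linter.unusedSectionVars false
namespace LC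
open IsLocalRing Module

section scm
variable {R : Type u} [CommRing R] [IsLocalRing R]
 {A M N L : Type u} [AddCommGroup M] [Module R M] [AddCommGroup N] [Module R N]
  [AddCommGroup L] [Module R L] [AddCommGroup A] [Module R A]

theorem mdim_congr (e : M ≃ₗ[R] N) : Paper.mdim R M = Paper.mdim R N := by
  unfold Paper.mdim; rw [e.annihilator_eq]

theorem CM_congr (e : M ≃ₗ[R] N) : Paper.IsCM R M ↔ Paper.IsCM R N := by
  unfold Paper.IsCM Paper.depth
  simp only [e.isRegular_congr, mdim_congr e]

/-- inductive form of sequential Cohen-Macaulayness -/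
inductive SC (R : Type u) [CommRing R] [IsLocalRing R] (M : Type u) [AddCommGroup M] [Module R M] :
    Submodule R M → Prop
  | base : SC R M (Paper.H0sub R M)
  | step (P : Submodule R M) (h : Paper.IsCM R (Paper.subQuot R M P (Paper.uComp R M P)))
      (h2 : SC R M (Paper.uComp R M P)) : SC R M P

theorem SC_of_filt : ∀ (t : ℕ) (D : Fin (t+1) → Submodule R M), 
    (∀ i : Fin t, D i.castSucc = Paper.uComp R M (D i.succ)) → D 0 = Paper.H0sub R M →
    (∀ i : Fin t, Paper.IsCM R (Paper.subQuot R M (D i.succ) (D i.castSucc))) → SC R M (D (Fin.last t))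
  | 0, D, h1, h2, h3 => by
    have : D (Fin.last 0) = Paper.H0sub R M := h2
    rw [this]; exact SC.base
  | t+1, D, h1, h2, h3 => by
    have ih := SC_of_filt t (fun i => D i.castSucc) (fun i => h1 i.castSucc) h2 (fun i => h3 i.castSucc)
    have e := h1 (Fin.last t)
    have c := h3 (Fin.last t)
    have ih : SC R M (D (Fin.last t).castSucc) := ih
    rw [e] at c ih
    exact SC.step _ c ih

theorem filt_of_SC {P : Submodule R M} (h : SC R M P) : ∃ (t : ℕ) (D : Fin (t+1) → Submodule R M), 
    D (Fin.last t) = P ∧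
    (∀ i : Fin t, D i.castSucc = Paper.uComp R M (D i.succ)) ∧ D 0 = Paper.H0sub R M ∧
    (∀ i : Fin t, Paper.IsCM R (Paper.subQuot R M (D i.succ) (D i.castSucc))) := by
  induction h with
  | base => exact ⟨0, fun _ => _, rfl, fun i => i.elim0, rfl, fun i => i.elim0⟩
  | step P hc _ ih =>
    obtain ⟨t, D, h1, h2, h3, h4⟩ := ih
    let D' : Fin (t+2) → Submodule R M := Fin.snoc D P
    have e1 : ∀ i : Fin (t+1), D' i.castSucc = D i := fun i => Fin.snoc_castSucc (α := fun _ => Submodule R M) _ _ i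
    have e2 : D' (Fin.last (t+1)) = P := Fin.snoc_last (α := fun _ => Submodule R M) _ _
    have e3 : ∀ i : Fin t, D' i.castSucc.succ = D i.succ := fun i => e1 i.succ
    have e4 : D' (Fin.last t).succ = P := e2
    refine ⟨t+1, D', e2, fun i => ?_, (e1 0).trans h3, fun i => ?_⟩
    · induction i using Fin.lastCases with
      | last => rw [e1, e4, h1]
      | cast i => rw [e1, e3, h2]
    · induction i using Fin.lastCases with
      | last => rw [e1, e4, h1]; exact hc
      | cast i => rw [e1, e3]; exact h4 i

theorem seqCM_iff_SC : Paper.IsSeqCM R M ↔ SC R M ⊤ := by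
  constructor
  · rintro ⟨t, D, ⟨h1, h2, h3⟩, h4⟩
    rw [← h1]; exact SC_of_filt t D h2 h3 h4
  · intro h
    obtain ⟨t, D, h1, h2, h3, h4⟩ := filt_of_SC h
    exact ⟨t, D, ⟨h1, h2, h3⟩, h4⟩

theorem map_mdim (f : A →ₗ[R] M) (hf : Function.Injective f) (P : Submodule R A) :
    Paper.mdim R (P.map f) = Paper.mdim R P := (mdim_congr (Submodule.equivMapOfInjective f hf P)).symm

theorem map_uComp (f : A →ₗ[R] M) (hf : Function.Injective f) (P : Submodule R A) :
    Paper.uComp R M (P.map f) = (Paper.uComp R A P).map f := by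
  unfold Paper.uComp
  rw [(Submodule.gc_map_comap f).l_sSup]
  apply le_antisymm
  · apply sSup_le
    rintro W ⟨h1, h2⟩
    have hW : (W.comap f).map f = W := Submodule.map_comap_eq_self (h1.trans LinearMap.map_le_range)
    rw [← hW]
    refine le_iSup₂_of_le (W.comap f) ⟨?_, ?_⟩ le_rfl
    · rw [← Submodule.map_le_map_iff_of_injective hf, hW]; exact h1
    · rw [← map_mdim f hf, ← map_mdim f hf P, hW]; exact h2
  · apply iSup₂_le
    rintro W ⟨h1, h2⟩
    apply le_sSup
    exact ⟨Submodule.map_mono h1, by rw [map_mdim f hf, map_mdim f hf]; exact h2⟩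

noncomputable def subQuotMap (f : A →ₗ[R] M) (hf : Function.Injective f) (P W : Submodule R A) :
    Paper.subQuot R A P W ≃ₗ[R] Paper.subQuot R M (P.map f) (W.map f) :=
  Submodule.Quotient.equiv _ _ (Submodule.equivMapOfInjective f hf P) (by
    ext ⟨m, hm⟩
    simp only [Submodule.mem_map, Submodule.mem_comap, Submodule.subtype_apply]
    constructor
    · rintro ⟨p, h1, h2⟩
      exact ⟨p, h1, congrArg Subtype.val h2⟩
    · rintro ⟨w, h1, h2⟩
      obtain ⟨p, hp, h3⟩ := hm
      have : w = p := hf (h2.trans h3.symm)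
      subst this
      exact ⟨⟨w, hp⟩, h1, Subtype.ext h2⟩)

theorem SC_map (f : A →ₗ[R] M) (hf : Function.Injective f) (h0 : (Paper.H0sub R A).map f = Paper.H0sub R M)
    (P : Submodule R A) : SC R A P ↔ SC R M (P.map f) := by
  constructor
  · intro h
    induction h with
    | base => rw [h0]; exact SC.base
    | step P hc _ ih =>
      apply SC.step
      · rw [map_uComp f hf, ← CM_congr (subQuotMap f hf _ _)]; exact hc
      · rw [map_uComp f hf]; exact ih
  · intro h
    generalize hW : P.map f = W at h
    induction h generalizing P with
    | base =>
      have : P = Paper.H0sub R A := Submodule.map_injective_of_injective hf (hW.trans h0.symm)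
      rw [this]; exact SC.base
    | step W hc _ ih =>
      subst hW
      rw [map_uComp f hf, ← CM_congr (subQuotMap f hf _ _)] at hc
      exact SC.step _ hc (ih _ (map_uComp f hf P).symm)

theorem mem_H0sub (m : M) : m ∈ Paper.H0sub R M ↔ ∃ n, ∀ r ∈ maximalIdeal R ^ n, r • m = 0 := by
  unfold Paper.H0sub
  rw [Submodule.mem_iSup_of_directed]
  · simp only [Submodule.mem_torsionBySet_iff, Subtype.forall, SetLike.mem_coe]
  · apply Monotone.directed_le
    intro a b hab m
    simp only [Submodule.mem_torsionBySet_iff, Subtype.forall, SetLike.mem_coe]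
    exact fun h r hr => h r (Ideal.pow_le_pow_right hab hr)

theorem map_H0sub (f : A →ₗ[R] M) (hf : Function.Injective f) (h : Paper.H0sub R M ≤ LinearMap.range f) :
    (Paper.H0sub R A).map f = Paper.H0sub R M := by
  ext m
  rw [Submodule.mem_map, mem_H0sub]
  constructor
  · rintro ⟨a, ha, rfl⟩
    obtain ⟨n, hn⟩ := (mem_H0sub a).1 ha
    exact ⟨n, fun r hr => by rw [← map_smul, hn r hr, map_zero]⟩
  · rintro ⟨n, hn⟩
    obtain ⟨a, rfl⟩ := h ((mem_H0sub m).2 ⟨n, hn⟩)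
    exact ⟨a, (mem_H0sub a).2 ⟨n, fun r hr => hf (by rw [map_smul, hn r hr, map_zero])⟩, rfl⟩

theorem seqCM_congr (e : M ≃ₗ[R] N) : Paper.IsSeqCM R M ↔ Paper.IsSeqCM R N := by
  rw [seqCM_iff_SC, seqCM_iff_SC, SC_map (e : M →ₗ[R] N) e.injective (map_H0sub _ e.injective (by
    rw [LinearEquiv.range]; exact le_top)), Submodule.map_top, LinearEquiv.range]

variable [IsNoetherianRing R]

/-- largest submodule of dimension at most `e` -/
noncomputable def Lg (R : Type u) [CommRing R] (M : Type u) [AddCommGroup M] [Module R M] (e : ℕ) : Submodule R M := sSup {P | dimLE R P e}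

theorem dimLE_le {P W : Submodule R M} (h : P ≤ W) {e} (hW : dimLE R W e) : dimLE R P e :=
  dimLE_of_inj (Submodule.inclusion h) (Submodule.inclusion_injective h) hW

theorem dimLE_sup {P W : Submodule R M} {e} (hP : dimLE R P e) (hW : dimLE R W e) : dimLE R (P ⊔ W : Submodule R M) e := by
  have h : P ≤ P ⊔ W := le_sup_left
  let e1 := (LinearMap.quotientInfEquivSupQuotient W P)
  have h2 := dimLE_of_surj (N := (↥(W ⊔ P) ⧸ Submodule.comap (W ⊔ P).subtype P))
    (e1.toLinearMap ∘ₗ Submodule.mkQ _) (e1.surjective.comp (Submodule.mkQ_surjective _)) hW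
  rw [sup_comm]
  refine dimLE_ext (SES.sub _) ?_ h2
  exact dimLE_congr (Submodule.comapSubtypeEquivOfLe (le_sup_right : P ≤ W ⊔ P)).symm hP

theorem dimLE_Lg [Module.Finite R M] (e : ℕ) : dimLE R (Lg R M e) e := by
  have h : IsNoetherian R M := inferInstance
  have := CompleteLattice.WellFoundedGT.isSupClosedCompact (Submodule R M) inferInstance {P | dimLE R P e}
    ⟨⊥, dimLE_sub e⟩ (fun P hP W hW => dimLE_sup hP hW)
  exact this

theorem le_Lg [Module.Finite R M] {e : ℕ} {P : Submodule R M} : P ≤ Lg R M e ↔ dimLE R P e :=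
  ⟨fun h => dimLE_le h (dimLE_Lg e), fun h => le_sSup h⟩

theorem sd_succ {d : ℕ} : supportDim R M = (d+1 : ℕ) ↔ dimLE R M (d+1) ∧ ¬ dimLE R M d := by
  unfold dimLE
  generalize supportDim R M = t
  induction t with
  | bot => exact ⟨fun h => absurd h.symm (WithBot.natCast_ne_bot _), fun h => absurd bot_le h.2⟩
  | coe t =>
    induction t with
    | top => 
      constructor
      · intro h; exact absurd (WithBot.coe_injective h) (ENat.natCast_ne_top (d+1)).symm
      · rintro ⟨h, -⟩; exact absurd (WithBot.coe_le_coe.1 h) (by simp)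
    | coe t =>
      have h1 : (((t : ℕ∞) : WithBot ℕ∞) = ((d+1 : ℕ) : WithBot ℕ∞)) ↔ t = d + 1 := by norm_cast
      have h2 : ∀ n : ℕ, (((t : ℕ∞) : WithBot ℕ∞) ≤ ((n : ℕ) : WithBot ℕ∞)) ↔ t ≤ n := fun n => by norm_cast
      rw [h1, h2, h2]; omega

theorem lt_succ_iff_dimLE {d : ℕ} : supportDim R M < (d+1 : ℕ) ↔ dimLE R M d := by
  unfold dimLE
  generalize supportDim R M = t
  induction t with
  | bot => simp
  | coe t =>
    induction t with
    | top => 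
      constructor
      · intro h; exact absurd h (by simp)
      · intro h; exact absurd (WithBot.coe_le_coe.1 h) (by simp)
    | coe t =>
      have h1 : (((t : ℕ∞) : WithBot ℕ∞) < ((d+1 : ℕ) : WithBot ℕ∞)) ↔ t < d + 1 := by norm_cast
      have h2 : ∀ n : ℕ, (((t : ℕ∞) : WithBot ℕ∞) ≤ ((n : ℕ) : WithBot ℕ∞)) ↔ t ≤ n := fun n => by norm_cast
      rw [h1, h2]; omega

theorem uc_eq [Module.Finite R M] {d : ℕ} (h : supportDim R M = (d+1 : ℕ)) : Paper.uComp R M ⊤ = Lg R M d := by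
  unfold Paper.uComp Lg
  congr 1
  ext P
  change (P ≤ ⊤ ∧ _) ↔ dimLE R P d
  rw [mdim_congr (Submodule.topEquiv (R := R) (M := M)), mdim_eq, mdim_eq, h]
  exact ⟨fun h' => lt_succ_iff_dimLE.1 h'.2, fun h' => ⟨le_top, lt_succ_iff_dimLE.2 h'⟩⟩

theorem seqCM_dim0 [Module.Finite R M] (h : dimLE R M 0) : Paper.IsSeqCM R M := by
  rw [seqCM_iff_SC]
  have : Paper.H0sub R M = ⊤ := by
    rw [eq_top_iff]; intro m _
    exact (mem_H0sub m).2 (tors_of_dim0 h m)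
  rw [← this]; exact SC.base

theorem H0_le_Lg [Module.Finite R M] (d : ℕ) : Paper.H0sub R M ≤ Lg R M d := by
  rw [le_Lg]
  apply dimLE_mono (Nat.zero_le d)
  apply dim0_of_tors
  rintro ⟨m, hm⟩
  obtain ⟨n, hn⟩ := (mem_H0sub m).1 hm
  exact ⟨n, fun r hr => Subtype.ext (hn r hr)⟩

theorem seqCM_succ [Module.Finite R M] {d : ℕ} (h : supportDim R M = (d+1 : ℕ)) :
    Paper.IsSeqCM R M ↔ Paper.IsCM R (M ⧸ Lg R M d) ∧ Paper.IsSeqCM R (Lg R M d) := by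
  have hr : LinearMap.range (Lg R M d).subtype = Lg R M d := Submodule.range_subtype _
  rw [seqCM_iff_SC (M := Lg R M d), SC_map (Lg R M d).subtype (Submodule.injective_subtype _)
    (map_H0sub _ (Submodule.injective_subtype _) (by rw [hr]; exact H0_le_Lg d)), Submodule.map_top, hr, seqCM_iff_SC]
  have e : Paper.subQuot R M ⊤ (Lg R M d) ≃ₗ[R] M ⧸ Lg R M d :=
    Submodule.Quotient.equiv _ _ Submodule.topEquiv (by
      ext m; simp [Submodule.topEquiv])
  rw [← CM_congr e, ← uc_eq h]
  constructor
  · intro h'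
    generalize ht : (⊤ : Submodule R M) = T at h'
    cases h' with
    | base =>
      exfalso
      have h1 := H0_le_Lg (R := R) (M := M) 0
      rw [← ht, le_Lg] at h1
      exact (sd_succ.1 h).2 (dimLE_mono (Nat.zero_le d) (dimLE_congr Submodule.topEquiv h1))
    | step _ h1 h2 => subst ht; exact ⟨h1, h2⟩
  · rintro ⟨h1, h2⟩; exact SC.step _ h1 h2

end scm
end LC
end part11

section part12
set_option linter.unusedSectionVars false
namespace LC
open IsLocalRing Module
open scoped Pointwise

section fin
variable {R : Type u} [CommRing R] [IsLocalRing R] [IsNoetherianRing R]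
 {M N L : Type u} [AddCommGroup M] [Module R M] [AddCommGroup N] [Module R N]
  [AddCommGroup L] [Module R L]

theorem sd_reg [Module.Finite R M] {y : R} (hy : y ∈ maximalIdeal R) (h : IsSMulRegular M y) {d : ℕ} :
    supportDim R (QuotSMulTop y M) = (d : ℕ) ↔ supportDim R M = (d+1 : ℕ) := by
  have := supportDim_quotSMulTop_succ_eq_supportDim h hy
  rw [← this]
  generalize supportDim R (QuotSMulTop y M) = t
  induction t with
  | bot => exact ⟨fun h => absurd h.symm (WithBot.natCast_ne_bot _), fun h => absurd h.symm (WithBot.natCast_ne_bot _)⟩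
  | coe t =>
    induction t with
    | top =>
      exact ⟨fun h => absurd (WithBot.coe_injective h) (ENat.natCast_ne_top _).symm,
        fun h => absurd (WithBot.coe_injective h) (ENat.natCast_ne_top (d+1)).symm⟩
    | coe t => norm_cast; omega

theorem dimLE_reg [Module.Finite R M] {y : R} (hy : y ∈ maximalIdeal R) (h : IsSMulRegular M y) {d : ℕ} 
    (hM : dimLE R M (d+1)) : dimLE R (QuotSMulTop y M) d := by
  have := supportDim_quotSMulTop_succ_eq_supportDim h hy
  unfold dimLE at *
  rw [← this] at hM
  revert hM
  generalize supportDim R (QuotSMulTop y M) = t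
  induction t with
  | bot => exact fun _ => bot_le
  | coe t =>
    induction t with
    | top =>
      intro h
      exact absurd (top_le_iff.1 (WithBot.coe_le_coe.1 h)) (ENat.natCast_ne_top (d+1))
    | coe t => intro h; norm_cast at h ⊢; omega

theorem Lg_bot : ∀ (e : ℕ) (C : Type u) [AddCommGroup C] [Module R C] [Module.Finite R C],
    (∀ i ≤ e, HZ (R := R) C i) → Lg R C e = ⊥
  | 0, C, _, _, _, h => by
    rw [eq_bot_iff]
    intro c hc
    obtain ⟨n, hn⟩ := tors_of_dim0 (dimLE_Lg (R := R) (M := C) 0) ⟨c, hc⟩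
    obtain ⟨ξ, rfl⟩ := ev_surj (mm R) n c (fun r hr => congrArg Subtype.val (hn r hr))
    rw [h 0 le_rfl ξ, map_zero]; exact Submodule.zero_mem _
  | e+1, C, _, _, _, h => by
    obtain ⟨y, hy, hr⟩ := reg_of_H0 (h 0 (Nat.zero_le _))
    have ih := Lg_bot e (QuotSMulTop y C) (fun i hi => HZ_right (reg_ses y hr) (h i (by omega)) (h (i+1) (by omega)))
    have hP := dimLE_Lg (R := R) (M := C) (e+1)
    set P := Lg R C (e+1) with hPd
    have hrP : IsSMulRegular P y := fun a b hab => Subtype.ext (hr (congrArg Subtype.val hab))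
    have h1 := dimLE_reg hy hrP hP
    have h2 : LinearMap.range (QuotSMulTop.map y P.subtype) ≤ Lg R (QuotSMulTop y C) e :=
      le_Lg.2 (dimLE_of_surj _ (LinearMap.surjective_rangeRestrict (QuotSMulTop.map y P.subtype)) h1)
    rw [ih] at h2
    have h3 : P.comap (LinearMap.lsmul R C y) ≤ P := by
      rw [hPd, le_Lg, ← hPd]
      exact dimLE_of_inj ((LinearMap.lsmul R C y).restrict (p := P.comap (LinearMap.lsmul R C y)) (q := P) (fun c hc => hc))
        (fun a b hab => Subtype.ext (hr (congrArg Subtype.val hab))) hP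
    apply Submodule.eq_bot_of_le_smul_of_le_jacobson_bot (Ideal.span {y}) P (IsNoetherian.noetherian P)
    · intro p hp
      have h4 : QuotSMulTop.map y P.subtype (Submodule.Quotient.mk ⟨p, hp⟩) = 0 := by
        have := h2 ⟨_, rfl⟩ (x := QuotSMulTop.map y P.subtype (Submodule.Quotient.mk ⟨p, hp⟩))
        simpa using this
      have h5 : p ∈ (y • ⊤ : Submodule R C) := (Submodule.Quotient.mk_eq_zero _).1 h4
      obtain ⟨c, -, rfl⟩ := (Submodule.mem_smul_pointwise_iff_exists _ _ _).1 h5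
      exact Submodule.smul_mem_smul (Ideal.mem_span_singleton_self y) (h3 hp)
    · rw [IsLocalRing.jacobson_eq_maximalIdeal ⊥ bot_ne_top, Ideal.span_singleton_le_iff_mem]; exact hy

theorem sd_eq_dimLE {d : ℕ} (h : supportDim R M = (d : ℕ)) : dimLE R M d := h.le

theorem seqCM_ext [Module.Finite R M] (K : Submodule R M) {d : ℕ} (hC : supportDim R (M ⧸ K) = (d : ℕ))
    (hz : ∀ i < d, HZ (R := R) (M ⧸ K) i) (hK : dimLE R K d) : 
    Paper.IsSeqCM R K ↔ Paper.IsSeqCM R M := by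
  have hM := dimLE_ext (SES.sub K) hK (sd_eq_dimLE hC)
  cases d with
  | zero => exact iff_of_true (seqCM_dim0 hK) (seqCM_dim0 hM)
  | succ e =>
    have hsM : supportDim R M = (e+1 : ℕ) := sd_succ.2 ⟨hM, fun h => (sd_succ.1 hC).2 
      (dimLE_of_surj _ K.mkQ_surjective h)⟩
    have hV := Lg_bot e (M ⧸ K) (fun i hi => hz i (by omega))
    have hWK : Lg R M e ≤ K := by
      have : (Lg R M e).map K.mkQ ≤ Lg R (M ⧸ K) e :=
        le_Lg.2 (dimLE_of_surj (K.mkQ.submoduleMap (Lg R M e)) (LinearMap.submoduleMap_surjective _ _) (dimLE_Lg e))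
      rw [hV, Submodule.map_le_iff_le_comap, Submodule.comap_bot, Submodule.ker_mkQ] at this
      exact this
    rw [seqCM_succ hsM]
    by_cases hKe : dimLE R K e
    · have hW : Lg R M e = K := le_antisymm hWK (le_Lg.2 hKe)
      rw [hW, CM_iff hC]
      exact ⟨fun h => ⟨hz, h⟩, fun h => h.2⟩
    · have hsK : supportDim R K = (e+1 : ℕ) := sd_succ.2 ⟨hK, hKe⟩
      rw [seqCM_succ hsK]
      have hLK : Lg R K e = (Lg R M e).comap K.subtype := by
        apply le_antisymm
        · rw [← Submodule.map_le_iff_le_comap, le_Lg]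
          exact dimLE_congr (Submodule.equivMapOfInjective _ K.injective_subtype _) (dimLE_Lg e)
        · rw [le_Lg]
          exact dimLE_congr (Submodule.comapSubtypeEquivOfLe hWK).symm (dimLE_Lg e)
      rw [hLK, seqCM_congr (Submodule.comapSubtypeEquivOfLe hWK)]
      apply and_congr_left'
      have ses : SES (Submodule.mapQ ((Lg R M e).comap K.subtype) (Lg R M e) K.subtype le_rfl)
          (Submodule.factor hWK) := by
        refine ⟨?_, ?_, Submodule.factor_surjective _⟩
        · rw [← LinearMap.ker_eq_bot, Submodule.ker_mapQ, Submodule.mkQ_map_self]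
        · intro z
          obtain ⟨m, rfl⟩ := Submodule.mkQ_surjective _ z
          rw [Submodule.factor_mk, Submodule.mkQ_apply, Submodule.mkQ_apply, Submodule.Quotient.mk_eq_zero]
          constructor
          · intro h; exact ⟨Submodule.Quotient.mk ⟨m, h⟩, rfl⟩
          · rintro ⟨w, hw⟩
            obtain ⟨k, rfl⟩ := Submodule.mkQ_surjective _ w
            have := (Submodule.Quotient.eq _).1 hw
            have h2 := K.sub_mem k.2 (hWK this)
            simpa using h2
      have d1 : supportDim R (K ⧸ (Lg R M e).comap K.subtype) = (e+1 : ℕ) := by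
        refine sd_succ.2 ⟨dimLE_of_surj _ (Submodule.mkQ_surjective _) hK, fun h => hKe (dimLE_ext (SES.sub _) ?_ h)⟩
        rw [← hLK]; exact dimLE_Lg e
      have d2 : supportDim R (M ⧸ Lg R M e) = (e+1 : ℕ) := by
        exact sd_succ.2 ⟨dimLE_of_surj _ (Submodule.mkQ_surjective _) hM, 
          fun h => (sd_succ.1 hsM).2 (dimLE_ext (SES.sub _) (dimLE_Lg e) h)⟩
      rw [CM_iff d1, CM_iff d2]
      constructor
      · exact fun h i hi => HZ_mid ses (h i hi) (hz i hi)
      · intro h i hi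
        cases i with
        | zero => exact HZ_left0 ses.inj (h 0 hi)
        | succ i => exact HZ_left ses (h _ hi) (hz i (by omega))

theorem torsion_eq_Lg [Module.Finite R M] {d : ℕ} {x : R} (hM : dimLE R M (d+1)) 
    (hb : x ∈ Paper.bIdeal R M (d+1)) (hQ : dimLE R (Q x M) d) : 
    Submodule.torsionBy R M x = Lg R M d := by
  apply le_antisymm (le_Lg.2 (dimLE_K hQ))
  obtain ⟨y, hy, hyL, hyQ⟩ := D4 hM (dimLE_Lg (R := R) (M := M) d)
  intro u hu
  rw [Submodule.mem_torsionBy_iff]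
  exact B1 hb hy hyQ u (congrArg Subtype.val (Module.mem_annihilator.1 hyL ⟨u, hu⟩))

theorem reg_bar [Module.Finite R M] {d : ℕ} {x : R} (hM : dimLE R M (d+1)) 
    (hb : x ∈ Paper.bIdeal R M (d+1)) (hQ : dimLE R (Q x M) d) : 
    IsSMulRegular (M ⧸ Submodule.torsionBy R M x) x := by
  have hQ2 : dimLE R (Q (x*x) M) d := by
    refine dimLE_of_supp hQ ?_
    rw [supp_Q, supp_Q]
    rintro p ⟨h1, h2⟩
    refine ⟨h1, ?_⟩
    rw [PrimeSpectrum.mem_zeroLocus, Set.singleton_subset_iff, SetLike.mem_coe] at h2 ⊢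
    exact (p.2.mem_or_mem h2).elim id id
  have h2 : Submodule.torsionBy R M (x*x) ≤ Submodule.torsionBy R M x := by
    rw [torsion_eq_Lg hM hb hQ]; exact le_Lg.2 (dimLE_K hQ2)
  rw [isSMulRegular_iff_right_eq_zero_of_smul]
  intro z hz
  obtain ⟨m, rfl⟩ := Submodule.mkQ_surjective _ z
  rw [← map_smul] at hz
  have h3 := (Submodule.Quotient.mk_eq_zero _).1 hz
  apply (Submodule.Quotient.mk_eq_zero _).2
  apply h2
  rw [Submodule.mem_torsionBy_iff] at h3 ⊢
  rw [mul_smul]; exact h3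

theorem seqCM_step [Module.Finite R M] {d : ℕ} {x : R} (hM : supportDim R M = (d+1 : ℕ)) 
    (hx : x ∈ maximalIdeal R) (hb : x ∈ Paper.bIdeal R M (d+1) ^ 3) (hQ : dimLE R (Q x M) d) : 
    Paper.IsSeqCM R M ↔ (∀ i < d, HZ (R := R) (M ⧸ Submodule.torsionBy R M x) (i+1)) ∧ Paper.IsSeqCM R (Q x M) := by
  have hb1 : x ∈ Paper.bIdeal R M (d+1) := Ideal.pow_le_self (by norm_num) hb
  have hM1 := (sd_succ.1 hM).1
  have hKL := torsion_eq_Lg hM1 hb1 hQ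
  have hreg := reg_bar hM1 hb1 hQ
  have h0 := H0bar hM1 hx hb hQ
  have hKd := dimLE_K hQ
  rw [seqCM_succ hM, ← hKL]
  set K := Submodule.torsionBy R M x with hK
  have hdb : supportDim R (M ⧸ K) = (d+1 : ℕ) := sd_succ.2 ⟨dimLE_of_surj _ (Submodule.mkQ_surjective _) hM1, 
          fun h => (sd_succ.1 hM).2 (dimLE_ext (SES.sub _) hKd h)⟩
  have hCM : Paper.IsCM R (M ⧸ K) ↔ ∀ i < d, HZ (R := R) (M ⧸ K) (i+1) := by
    rw [CM_iff hdb]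
    constructor
    · exact fun h i hi => h _ (by omega)
    · intro h i hi
      cases i with
      | zero => exact h0
      | succ i => exact h i (by omega)
  rw [hCM]
  apply and_congr_right
  intro hz
  let p : Submodule R M := Ideal.span {x} • ⊤
  have hpK : ∀ u ∈ K, u ∈ p → u = 0 := by
    intro u hu hp
    obtain ⟨n, rfl⟩ := (mem_span_smul_top x u).1 hp
    have : (Submodule.Quotient.mk n : M ⧸ K) = 0 := by
      apply isSMulRegular_iff_right_eq_zero_of_smul.1 hreg
      exact (Submodule.Quotient.mk_eq_zero _).2 hu
    exact (Submodule.mem_torsionBy_iff x n).1 ((Submodule.Quotient.mk_eq_zero _).1 this)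
  have hinj : Function.Injective (p.mkQ ∘ₗ K.subtype) := by
    rw [← LinearMap.ker_eq_bot, LinearMap.ker_eq_bot']
    rintro ⟨u, hu⟩ h
    exact Subtype.ext (hpK u hu ((Submodule.Quotient.mk_eq_zero _).1 h))
  let K' : Submodule R (Q x M) := LinearMap.range (p.mkQ ∘ₗ K.subtype)
  have eK : K ≃ₗ[R] K' := LinearEquiv.ofInjective _ hinj
  have hK' : K' = K.map p.mkQ := by
    change LinearMap.range (p.mkQ ∘ₗ K.subtype) = _
    rw [LinearMap.range_comp, Submodule.range_subtype]
  have e2 : (Q x M ⧸ K') ≃ₗ[R] QuotSMulTop x (M ⧸ K) := by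
    have a1 : (Q x M ⧸ K') ≃ₗ[R] ((M ⧸ p) ⧸ K.map p.mkQ) := Submodule.quotEquivOfEq K' (K.map p.mkQ) hK'
    have a2 := Submodule.quotientQuotientEquivQuotientSup p K
    have a3 := Submodule.quotEquivOfEq _ _ (sup_comm p K)
    have a4 := Submodule.quotientQuotientEquivQuotientSup K p
    have a5 : p.map K.mkQ = x • ⊤ := by
      change (Ideal.span {x} • ⊤ : Submodule R M).map K.mkQ = _
      rw [Submodule.map_smul'', Submodule.map_top, Submodule.range_mkQ, Submodule.ideal_span_singleton_smul]
    have a6 : ((M ⧸ K) ⧸ p.map K.mkQ) ≃ₗ[R] QuotSMulTop x (M ⧸ K) := Submodule.quotEquivOfEq _ _ a5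
    exact (((a1.trans a2).trans a3).trans a4.symm).trans a6
  rw [seqCM_congr eK]
  refine seqCM_ext K' (d := d) ?_ ?_ (dimLE_congr eK hKd)
  · rw [supportDim_eq_of_equiv e2, sd_reg hx hreg]; exact hdb
  · intro i hi
    refine HZ_congr e2.symm (HZ_right (reg_ses x hreg) ?_ (hz i hi))
    cases i with
    | zero => exact h0
    | succ i => exact hz i (by omega)

theorem socH_zero_iff {i : ℕ} (hf : fsoc (maximalIdeal R) (HH (mm R) i M)) : Paper.socH R M i = 0 ↔ HZ (R := R) M i := by
  constructor
  · intro h ξ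
    exact zero_of_soc (HH_tors _ _) hf h ξ
  · intro h
    unfold Paper.socH Paper.socDim
    have : Subsingleton (Submodule.torsionBySet R ((localCohomology (maximalIdeal R) i).obj (ModuleCat.of R M)) (maximalIdeal R : Set R)) :=
      ⟨fun a b => Subtype.ext ((h a.1).trans (h b.1).symm)⟩
    exact Module.finrank_zero_of_subsingleton

theorem fsoc_fin [Module.Finite R M] : fsoc (maximalIdeal R) M := by
  unfold fsoc
  have : Module.Finite R (Submodule.torsionBySet R M (maximalIdeal R : Set R)) := inferInstance
  exact Module.Finite.of_restrictScalars_finite R _ _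

theorem final : ∀ (d : ℕ) (M : Type u) [AddCommGroup M] [Module R M] [Module.Finite R M], 
    supportDim R M = (d : ℕ) → ∀ x, Paper.IsCSOP R M d x → 
    (∀ i ≤ d, fsoc (maximalIdeal R) (HH (mm R) i M)) ∧
    ∑ i ∈ Finset.range (d+1), Paper.socH R M i ≤ Paper.ir R M (Ideal.span (Set.range x)) ∧
    (Paper.ir R M (Ideal.span (Set.range x)) = ∑ i ∈ Finset.range (d+1), Paper.socH R M i ↔ Paper.IsSeqCM R M)
  | 0, M, _, _, _, hM, x, hx => by
    have h0 := sd_eq_dimLE hM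
    have e : HH (mm R) 0 M ≃ₗ[R] M := LinearEquiv.ofBijective (ev (mm R)) ⟨ev_inj _, fun m => by
      obtain ⟨n, hn⟩ := tors_of_dim0 h0 m
      exact ev_surj _ n m hn⟩
    have h1 : Paper.ir R M (Ideal.span (Set.range x)) = ∑ i ∈ Finset.range (0+1), Paper.socH R M i := by
      rw [Finset.sum_range_one]
      exact (socDim_congr _ (quotBot (Ideal.span (Set.range x)) (by simp))).trans (socDim_congr _ e).symm
    refine ⟨fun i hi => ?_, h1.ge, iff_of_true h1 (seqCM_dim0 h0)⟩
    obtain rfl : i = 0 := by omega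
    exact fsoc_congr e.symm fsoc_fin
  | d+1, M, _, _, _, hM, x, hx => by
    obtain ⟨hb, hc⟩ := csop_last x hx
    have hQ := dim_Q hx.1 hM
    have hxm := hx.1.1 (Fin.last d)
    obtain ⟨f1, f2, f3⟩ := final d (Q (x (Fin.last d)) M) hQ _ hc
    have hQ' := sd_eq_dimLE hQ
    obtain ⟨g1, g2, g3⟩ := main_step (sd_succ.1 hM).1 hxm hb hQ' f1
    have hs := seqCM_step hM hxm hb hQ'
    have hz : (∑ i ∈ Finset.range d, Paper.socH R (M ⧸ Submodule.torsionBy R M (x (Fin.last d))) (i+1) = 0) ↔ 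
       ∀ i < d, HZ (R := R) (M ⧸ Submodule.torsionBy R M (x (Fin.last d))) (i+1) := by
      rw [Finset.sum_eq_zero_iff]
      constructor
      · exact fun h i hi => (socH_zero_iff (g2 i hi.le)).1 (h i (Finset.mem_range.2 hi))
      · exact fun h i hi => (socH_zero_iff (g2 i (Finset.mem_range.1 hi).le)).2 (h i (Finset.mem_range.1 hi))
    rw [ir_eq x, hs, ← f3, ← hz]
    rw [show d + 1 + 1 = d + 2 from rfl]
    refine ⟨g1, ?_, ?_⟩
    · omega
    · omega

end fin
end LC
end part12

/-- `N_R(M) = Σ_{i=0}^{d} dim_k Soc(H^i_m(M))` iff `M` is sequentially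
Cohen-Macaulay. -/
theorem stmt3 (R : Type u) [CommRing R] [IsLocalRing R] [IsNoetherianRing R]
    (hCM : IsQuotientOfCMLocalRing R)
    (M : Type u) [AddCommGroup M] [Module R M] [Module.Finite R M]
    (d : ℕ) (hd : 0 < d) (hdim : mdim R M = d)
    (x : Fin d → R) (hx : IsCSOP R M d x) :
    ir R M (Ideal.span (Set.range x)) = ∑ i ∈ Finset.range (d + 1), socH R M i ↔
      IsSeqCM R M := by
  exact (LC.final d M (LC.mdim_eq.symm.trans hdim) x hx).2.2
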